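/- arXiv:2501.10090 — 4 statements merged into one kernel-verified Lean document; each statement's English description precedes it below -/
import Mathlib

section
/- Let p, q : ℕ → ℝ both satisfy the recurrence u(n) = (44n² + 1)·u(n-1) + (2n-1)⁴·u(n-2) for all n ≥ 2, with initial values p(0) = 80, p(1) = 80·47 - 160 = 3600, q(0) = 1, q(1) = 47. Then q(n) ≠ 0 for all n, the sequence p(n)/q(n) converges to S = (Γ(1/4)/Γ(3/4))⁴, and moreover S - p(n)/q(n) is asymptotically equivalent (as n → ∞) to (-1)^{n+1}·8S/((1+√5)/2)^{10n+10}. -/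
open Filter Real Asymptotics

/-- The `k`-th term of the well-poised series `₃F₂(a, 1/2, 1/2; a + 1/2, a + 1/2; 1)`. -/
noncomputable def dixonTerm (a : ℝ) : ℕ → ℝ
  | 0 => 1
  | k + 1 => dixonTerm a k * ((a + k) * (k + 1 / 2) ^ 2 / ((a + k + 1 / 2) ^ 2 * (k + 1)))

lemma dixonTerm_succ (a : ℝ) (k : ℕ) : dixonTerm a (k + 1) =
    dixonTerm a k * ((a + k) * (k + 1 / 2) ^ 2 / ((a + k + 1 / 2) ^ 2 * (k + 1))) := rfl

lemma dixonTerm_pos {a : ℝ} (ha : 0 < a) (k : ℕ) : 0 < dixonTerm a k := by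
  induction k with
  | zero => simp [dixonTerm]
  | succ k ih => rw [dixonTerm_succ]; positivity

lemma dixonTerm_add_two {a : ℝ} (ha : 0 < a) (k : ℕ) : dixonTerm (a + 2) k =
    dixonTerm a k * ((a + k) * (a + k + 1) / (a * (a + 1)) *
      ((a + 1 / 2) * (a + 3 / 2) / ((a + k + 1 / 2) * (a + k + 3 / 2))) ^ 2) := by
  induction k with
  | zero => simp [dixonTerm]; field_simp
  | succ k ih =>
    rw [dixonTerm_succ, dixonTerm_succ, ih]
    push_cast
    have h : (0 : ℝ) ≤ k := k.cast_nonneg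
    have h1 : a + k + 5 / 2 ≠ 0 := by positivity
    have h2 : a + (k + 1) + 3 / 2 ≠ 0 := by positivity
    have h3 : a + 2 + k + 1 / 2 ≠ 0 := by positivity
    field_simp
    ring

lemma sum_dixonTerm_recurrence {a : ℝ} (ha : 0 < a) (K : ℕ) :
    ∑ k ∈ Finset.range K, ((a + 1) ^ 4 * dixonTerm (a + 2) k
      - ((a + 1 / 2) * (a + 3 / 2)) ^ 2 * dixonTerm a k) =
    dixonTerm a K * ((a + 1 / 2) * (a + 3 / 2)) ^ 2 * K * (K ^ 2 + (3 * a + 1) * K + 2 * a ^ 2 + a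
      - 1 / 4) / (a * (a + K + 1 / 2) ^ 2) := by
  induction K with
  | zero => simp
  | succ k ih =>
    rw [Finset.sum_range_succ, ih, dixonTerm_succ, dixonTerm_add_two ha]
    push_cast
    have h : (0 : ℝ) ≤ k := k.cast_nonneg
    field_simp
    ring

lemma dixonTerm_half_sq_le (k : ℕ) : dixonTerm (1 / 2) k ^ 2 ≤ 1 / (2 * k + 1) ^ 3 := by
  induction k with
  | zero => simp [dixonTerm]
  | succ k ih =>
    rw [dixonTerm_succ, mul_pow]
    refine (mul_le_mul_of_nonneg_right ih (by positivity)).trans ?_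
    have e : 1 / (2 * (k : ℝ) + 1) ^ 3 * ((1 / 2 + k) * (k + 1 / 2) ^ 2 /
        ((1 / 2 + k + 1 / 2) ^ 2 * (k + 1))) ^ 2 = ((2 * k + 1) / (2 * k + 2) ^ 2) ^ 3 := by
      field_simp
      ring
    rw [e, ← one_div_pow]
    push_cast
    refine pow_le_pow_left₀ (by positivity) ?_ 3
    rw [div_le_div_iff₀ (by positivity) (by positivity)]
    nlinarith

lemma dixonTerm_half_le (k : ℕ) : dixonTerm (1 / 2) k ≤ ((k + 1 : ℕ) : ℝ) ^ (-(3 / 2) : ℝ) := by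
  refine (pow_le_pow_iff_left₀ (dixonTerm_pos (by norm_num) k).le (by positivity) two_ne_zero).1 ?_
  refine (dixonTerm_half_sq_le k).trans ?_
  rw [← Real.rpow_natCast _ 2, ← Real.rpow_mul (by positivity)]
  norm_num
  refine inv_anti₀ (by positivity) ?_
  gcongr
  linarith [k.cast_nonneg (α := ℝ)]

lemma summable_dixonTerm_half : Summable (dixonTerm (1 / 2)) := by
  refine Summable.of_nonneg_of_le (fun k => (dixonTerm_pos (by norm_num) k).le)
    dixonTerm_half_le ?_
  exact (summable_nat_add_iff (f := fun k : ℕ => (k : ℝ) ^ (-(3 / 2) : ℝ)) 1).2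
    (Real.summable_nat_rpow.2 (by norm_num))

lemma tendsto_mul_dixonTerm_half :
    Tendsto (fun k : ℕ => (k : ℝ) * dixonTerm (1 / 2) k) atTop (nhds 0) := by
  have h : Tendsto (fun k : ℕ => ((k + 1 : ℕ) : ℝ) ^ (-(1 / 2) : ℝ)) atTop (nhds 0) :=
    ((tendsto_rpow_neg_atTop (by norm_num)).comp tendsto_natCast_atTop_atTop).comp
      (tendsto_add_atTop_nat 1)
  refine squeeze_zero (fun k => mul_nonneg k.cast_nonneg (dixonTerm_pos (by norm_num) k).le)
    (fun k => ?_) h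
  have e : ((k + 1 : ℕ) : ℝ) ^ (-(1 / 2) : ℝ)
      = ((k + 1 : ℕ) : ℝ) * ((k + 1 : ℕ) : ℝ) ^ (-(3 / 2) : ℝ) := by
    rw [← Real.rpow_one_add' (by positivity) (by norm_num)]
    norm_num
  rw [e]
  exact mul_le_mul (by simp) (dixonTerm_half_le k) (dixonTerm_pos (by norm_num) k).le
    (by positivity)

lemma dixonTerm_ratio_anti {a : ℝ} (ha : 1 / 2 ≤ a) (k : ℕ) :
    (a + k) * (k + 1 / 2) ^ 2 / ((a + k + 1 / 2) ^ 2 * (k + 1)) ≤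
    (1 / 2 + k) * (k + 1 / 2) ^ 2 / ((1 / 2 + k + 1 / 2 : ℝ) ^ 2 * (k + 1)) := by
  have h : (0 : ℝ) ≤ k := k.cast_nonneg
  have h2 : (a + k) / (a + k + 1 / 2) ^ 2 ≤ (1 / 2 + k) / (1 / 2 + k + 1 / 2 : ℝ) ^ 2 := by
    rw [div_le_div_iff₀ (by positivity) (by positivity)]
    nlinarith [mul_nonneg (sub_nonneg.2 ha) h, mul_nonneg (mul_nonneg (sub_nonneg.2 ha) h) h,
      mul_nonneg (mul_nonneg (sub_nonneg.2 ha) h) (sub_nonneg.2 ha), sq_nonneg (a - 1 / 2)]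
  have e : ∀ x : ℝ, x * (k + 1 / 2) ^ 2 / ((x + 1 / 2) ^ 2 * (k + 1)) =
      x / (x + 1 / 2) ^ 2 * ((k + 1 / 2) ^ 2 / (k + 1)) := fun x => by
    rw [div_mul_div_comm]
  rw [e (a + k), e (1 / 2 + k)]
  gcongr

lemma dixonTerm_le {a : ℝ} (ha : 1 / 2 ≤ a) (k : ℕ) : dixonTerm a k ≤ dixonTerm (1 / 2) k := by
  induction k with
  | zero => simp [dixonTerm]
  | succ k ih =>
    rw [dixonTerm_succ, dixonTerm_succ]
    exact mul_le_mul ih (dixonTerm_ratio_anti ha k) (by positivity)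
      (dixonTerm_pos (by norm_num) k).le

lemma dixonTerm_succ_le {a : ℝ} (ha : 1 / 2 ≤ a) (k : ℕ) :
    dixonTerm a (k + 1) ≤ 2 / a * dixonTerm (1 / 2) (k + 1) := by
  induction k with
  | zero =>
    simp only [dixonTerm]
    norm_num
    field_simp
    nlinarith
  | succ k ih =>
    rw [dixonTerm_succ a, dixonTerm_succ (1 / 2), ← mul_assoc]
    exact mul_le_mul ih (dixonTerm_ratio_anti ha _) (by positivity)
      (mul_nonneg (by positivity) (dixonTerm_pos (by norm_num) _).le)

lemma summable_dixonTerm {a : ℝ} (ha : 1 / 2 ≤ a) : Summable (dixonTerm a) :=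
  Summable.of_nonneg_of_le (fun k => (dixonTerm_pos (by linarith) k).le) (dixonTerm_le ha)
    summable_dixonTerm_half

/-- The well-poised sum `₃F₂(a, 1/2, 1/2; a + 1/2, a + 1/2; 1)`. -/
noncomputable def dixonSum (a : ℝ) : ℝ := ∑' k, dixonTerm a k

lemma tendsto_dixonSum : Tendsto dixonSum atTop (nhds 1) := by
  have h0 : Tendsto (fun a : ℝ => 1 + 2 / a * ∑' k, dixonTerm (1 / 2) (k + 1)) atTop (nhds 1) := by
    have := (((tendsto_const_nhds (x := (2 : ℝ))).div_atTop tendsto_id).mul_const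
      (∑' k, dixonTerm (1 / 2) (k + 1))).const_add 1
    simpa using this
  refine tendsto_of_tendsto_of_tendsto_of_le_of_le' tendsto_const_nhds h0 ?_ ?_
  · filter_upwards [eventually_ge_atTop (1 / 2)] with a ha
    rw [dixonSum, (summable_dixonTerm ha).tsum_eq_zero_add]
    have : 0 ≤ ∑' k, dixonTerm a (k + 1) :=
      tsum_nonneg fun k => (dixonTerm_pos (by linarith) _).le
    simpa [dixonTerm] using this
  · filter_upwards [eventually_ge_atTop (1 / 2)] with a ha
    rw [dixonSum, (summable_dixonTerm ha).tsum_eq_zero_add]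
    have s1 := (summable_nat_add_iff 1).2 (summable_dixonTerm ha)
    have s2 := (summable_nat_add_iff 1).2 summable_dixonTerm_half
    have : ∑' k, dixonTerm a (k + 1) ≤ 2 / a * ∑' k, dixonTerm (1 / 2) (k + 1) := by
      rw [← tsum_mul_left]
      exact s1.tsum_le_tsum (dixonTerm_succ_le ha) (s2.mul_left _)
    simpa [dixonTerm] using this

lemma dixonSum_add_two {a : ℝ} (ha : 1 / 2 ≤ a) :
    (a + 1) ^ 4 * dixonSum (a + 2) = ((a + 1 / 2) * (a + 3 / 2)) ^ 2 * dixonSum a := by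
  have ha0 : 0 < a := by linarith
  have hs := (((summable_dixonTerm (show 1 / 2 ≤ a + 2 by linarith)).hasSum.mul_left
    ((a + 1) ^ 4)).sub ((summable_dixonTerm ha).hasSum.mul_left
      (((a + 1 / 2) * (a + 3 / 2)) ^ 2))).tendsto_sum_nat
  simp_rw [sum_dixonTerm_recurrence ha0] at hs
  have h0 : Tendsto (fun K : ℕ => dixonTerm a K * ((a + 1 / 2) * (a + 3 / 2)) ^ 2 * K *
      (K ^ 2 + (3 * a + 1) * K + 2 * a ^ 2 + a - 1 / 4) / (a * (a + K + 1 / 2) ^ 2))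
      atTop (nhds 0) := by
    have h1 := tendsto_mul_dixonTerm_half.mul_const (((a + 1 / 2) * (a + 3 / 2)) ^ 2 * 2 / a)
    rw [zero_mul] at h1
    refine squeeze_zero (fun K => ?_) (fun K => ?_) h1
    · have := (dixonTerm_pos ha0 K).le
      have : 0 ≤ (K : ℝ) ^ 2 + (3 * a + 1) * K + 2 * a ^ 2 + a - 1 / 4 := by
        have : (0 : ℝ) ≤ K := K.cast_nonneg
        nlinarith [sq_nonneg (K : ℝ), mul_nonneg ha0.le this]
      positivity
    · have hK : (0 : ℝ) ≤ K := K.cast_nonneg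
      have h2 : ((K : ℝ) ^ 2 + (3 * a + 1) * K + 2 * a ^ 2 + a - 1 / 4) / (a + K + 1 / 2) ^ 2
          ≤ 2 := by
        rw [div_le_iff₀ (by positivity)]
        nlinarith [mul_nonneg ha0.le hK]
      calc _ = dixonTerm a K * (K * (((a + 1 / 2) * (a + 3 / 2)) ^ 2 / a)) *
            (((K : ℝ) ^ 2 + (3 * a + 1) * K + 2 * a ^ 2 + a - 1 / 4) / (a + K + 1 / 2) ^ 2) := by
            field_simp
        _ ≤ dixonTerm (1 / 2) K * (K * (((a + 1 / 2) * (a + 3 / 2)) ^ 2 / a)) * 2 := by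
            have := (dixonTerm_pos (show (0 : ℝ) < 1 / 2 by norm_num) K).le
            refine mul_le_mul (mul_le_mul_of_nonneg_right (dixonTerm_le ha K) (by positivity)) h2
              ?_ (by positivity)
            have : 0 ≤ (K : ℝ) ^ 2 + (3 * a + 1) * K + 2 * a ^ 2 + a - 1 / 4 := by
              nlinarith [sq_nonneg (K : ℝ), mul_nonneg ha0.le hK]
            positivity
        _ = _ := by ring
  have := tendsto_nhds_unique hs h0
  unfold dixonSum
  linarith

/-- The quotient `Γ(x + 1/2)² / (Γ(x) Γ(x + 1))`. -/
noncomputable def gammaQuot (x : ℝ) : ℝ :=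
  Real.Gamma (x + 1 / 2) ^ 2 / (Real.Gamma x * Real.Gamma (x + 1))

lemma gammaQuot_pos {x : ℝ} (hx : 0 < x) : 0 < gammaQuot x := by
  have := Real.Gamma_pos_of_pos hx
  have := Real.Gamma_pos_of_pos (show 0 < x + 1 by linarith)
  have := Real.Gamma_pos_of_pos (show 0 < x + 1 / 2 by linarith)
  unfold gammaQuot
  positivity

lemma Gamma_midpoint_sq_le {x : ℝ} (hx : 0 < x) :
    Real.Gamma (x + 1 / 2) ^ 2 ≤ Real.Gamma x * Real.Gamma (x + 1) := by
  have h := Real.Gamma_mul_add_mul_le_rpow_Gamma_mul_rpow_Gamma hx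
    (show 0 < x + 1 by linarith) (show (0 : ℝ) < 1 / 2 by norm_num)
    (show (0 : ℝ) < 1 / 2 by norm_num) (by norm_num)
  have p1 := Real.Gamma_pos_of_pos hx
  have p2 := Real.Gamma_pos_of_pos (show 0 < x + 1 by linarith)
  have e : 1 / 2 * x + 1 / 2 * (x + 1) = x + 1 / 2 := by ring
  rw [e, ← Real.sqrt_eq_rpow, ← Real.sqrt_eq_rpow, ← Real.sqrt_mul p1.le] at h
  have p3 := Real.Gamma_pos_of_pos (show 0 < x + 1 / 2 by linarith)
  calc _ ≤ √(Real.Gamma x * Real.Gamma (x + 1)) ^ 2 := by gcongr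
    _ = _ := Real.sq_sqrt (by positivity)

lemma gammaQuot_add_one {x : ℝ} (hx : 0 < x) :
    gammaQuot (x + 1) = gammaQuot x * ((x + 1 / 2) ^ 2 / (x * (x + 1))) := by
  unfold gammaQuot
  rw [show x + 1 + 1 / 2 = (x + 1 / 2) + 1 by ring, Real.Gamma_add_one (s := x + 1) (by linarith),
    Real.Gamma_add_one (s := x + 1 / 2) (by linarith), Real.Gamma_add_one hx.ne']
  have := Real.Gamma_pos_of_pos hx
  field_simp

lemma tendsto_gammaQuot : Tendsto gammaQuot atTop (nhds 1) := by
  have h0 : Tendsto (fun x : ℝ => 1 - 1 / 2 / (x + 1 / 2)) atTop (nhds 1) := by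
    have := ((tendsto_const_nhds (x := (1 / 2 : ℝ))).div_atTop
      (tendsto_atTop_add_const_right atTop (1 / 2 : ℝ) tendsto_id)).const_sub 1
    simpa using this
  refine tendsto_of_tendsto_of_tendsto_of_le_of_le' h0 tendsto_const_nhds ?_ ?_
  · filter_upwards [eventually_gt_atTop 0] with x hx
    have h := Gamma_midpoint_sq_le (show 0 < x + 1 / 2 by linarith)
    have e1 : x + 1 / 2 + 1 / 2 = x + 1 := by ring
    have p1 := Real.Gamma_pos_of_pos hx
    have p3 := Real.Gamma_pos_of_pos (show 0 < x + 1 / 2 by linarith)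
    rw [e1, Real.Gamma_add_one (s := x + 1 / 2) (by linarith), Real.Gamma_add_one hx.ne'] at h
    unfold gammaQuot
    rw [Real.Gamma_add_one hx.ne', le_div_iff₀ (by positivity)]
    have e2 : 1 - 1 / 2 / (x + 1 / 2) = x / (x + 1 / 2) := by field_simp; ring
    rw [e2, div_mul_eq_mul_div, div_le_iff₀ (by positivity)]
    nlinarith
  · filter_upwards [eventually_gt_atTop 0] with x hx
    have p1 := Real.Gamma_pos_of_pos hx
    have p2 := Real.Gamma_pos_of_pos (show 0 < x + 1 by linarith)
    exact (div_le_one (by positivity)).2 (Gamma_midpoint_sq_le hx)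

lemma dixonSum_eq {a : ℝ} (ha : 1 / 2 ≤ a) : dixonSum a = gammaQuot a / gammaQuot (a / 2) := by
  have hper : ∀ j : ℕ, dixonSum (a + 2 * j) * gammaQuot ((a + 2 * j) / 2) / gammaQuot (a + 2 * j)
      = dixonSum a * gammaQuot (a / 2) / gammaQuot a := by
    intro j
    induction j with
    | zero => simp
    | succ j ih =>
      rw [← ih]
      set b := a + 2 * (j : ℝ) with hb
      have hb' : 1 / 2 ≤ b := by
        have : (0 : ℝ) ≤ j := j.cast_nonneg
        linarith
      have hb0 : 0 < b := by linarith
      have e : a + 2 * ((j + 1 : ℕ) : ℝ) = b + 2 := by push_cast; ring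
      rw [e, show (b + 2) / 2 = b / 2 + 1 by ring, show b + 2 = b + 1 + 1 by ring,
        gammaQuot_add_one (x := b / 2) (by linarith), gammaQuot_add_one (x := b + 1) (by linarith),
        gammaQuot_add_one hb0, show b + 1 + 1 = b + 2 by ring]
      have hd := dixonSum_add_two hb'
      have hd' : dixonSum (b + 2) = ((b + 1 / 2) * (b + 3 / 2)) ^ 2 * dixonSum b / (b + 1) ^ 4 := by
        rw [eq_div_iff (by positivity)]; linarith
      rw [hd']
      have := gammaQuot_pos hb0
      have h3 : b + 1 + 1 / 2 = b + 3 / 2 := by ring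
      have h4 : b / 2 + 1 / 2 = (b + 1) / 2 := by ring
      rw [h3, h4]
      field_simp
  have hinf : Tendsto (fun j : ℕ => a + 2 * (j : ℝ)) atTop atTop :=
    tendsto_atTop_add_const_left _ _
      (tendsto_natCast_atTop_atTop.const_mul_atTop (by norm_num : (0 : ℝ) < 2))
  have hlim := ((tendsto_dixonSum.comp hinf).mul
    (tendsto_gammaQuot.comp (hinf.atTop_div_const (by norm_num : (0 : ℝ) < 2)))).div
      (tendsto_gammaQuot.comp hinf) one_ne_zero
  simp only [Function.comp_def] at hlim
  have := tendsto_nhds_unique (tendsto_const_nhds.congr fun j => (hper j).symm) hlim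
  have p1 := gammaQuot_pos (show 0 < a by linarith)
  have p2 := gammaQuot_pos (show 0 < a / 2 by linarith)
  rw [mul_one, div_one, div_eq_one_iff_eq p1.ne'] at this
  rw [eq_div_iff p2.ne', this]

/-- The term `Γ(n + 1/2) Γ(n + k + 1/2)³ / (k! (2n + k)!²)`, defined by its ratio in `k`. -/
noncomputable def aperyTerm (n : ℕ) : ℕ → ℝ
  | 0 => Real.Gamma (n + 1 / 2) ^ 4 / ((2 * n).factorial : ℝ) ^ 2
  | k + 1 => aperyTerm n k * ((n + k + 1 / 2) ^ 3 / ((k + 1) * (2 * n + 1 + k) ^ 2))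

lemma aperyTerm_succ (n k : ℕ) : aperyTerm n (k + 1) =
    aperyTerm n k * ((n + k + 1 / 2) ^ 3 / ((k + 1) * (2 * n + 1 + k) ^ 2)) := rfl

lemma aperyTerm_pos (n k : ℕ) : 0 < aperyTerm n k := by
  induction k with
  | zero =>
    have := Real.Gamma_pos_of_pos (show (0 : ℝ) < n + 1 / 2 by positivity)
    rw [aperyTerm]; positivity
  | succ k ih => rw [aperyTerm_succ]; positivity

lemma aperyTerm_succ_left (n k : ℕ) : aperyTerm (n + 1) k = aperyTerm n k *
    ((n + 1 / 2) * (n + k + 1 / 2) ^ 3 / ((2 * n + 1 + k) * (2 * n + 2 + k)) ^ 2) := by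
  induction k with
  | zero =>
    simp only [aperyTerm]
    rw [show ((n + 1 : ℕ) : ℝ) + 1 / 2 = (n + 1 / 2) + 1 by push_cast; ring,
      Real.Gamma_add_one (s := (n : ℝ) + 1 / 2) (by positivity),
      show 2 * (n + 1) = 2 * n + 1 + 1 by ring, Nat.factorial_succ, Nat.factorial_succ]
    push_cast
    field_simp
    ring
  | succ k ih =>
    rw [aperyTerm_succ, aperyTerm_succ, ih]
    push_cast
    field_simp
    ring

lemma aperyTerm_zero_eq (k : ℕ) : aperyTerm 0 k = π ^ 2 * dixonTerm (1 / 2) k := by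
  induction k with
  | zero =>
    simp only [aperyTerm, dixonTerm]
    norm_num
    rw [Real.Gamma_one_half_eq, show (4 : ℕ) = 2 * 2 from rfl, pow_mul,
      Real.sq_sqrt pi_pos.le]
  | succ k ih =>
    rw [aperyTerm_succ, dixonTerm_succ, ih]
    push_cast
    field_simp
    ring

lemma exists_aperyTerm_le (n : ℕ) :
    ∃ C : ℝ, 0 ≤ C ∧ ∀ k, aperyTerm n k ≤ C * dixonTerm (1 / 2) k := by
  induction n with
  | zero => exact ⟨π ^ 2, by positivity, fun k => (aperyTerm_zero_eq k).le⟩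
  | succ n ih =>
    obtain ⟨C, hC, h⟩ := ih
    refine ⟨C * (n + 1 / 2), by positivity, fun k => ?_⟩
    rw [aperyTerm_succ_left]
    have h1 : (n + 1 / 2) * (n + k + 1 / 2) ^ 3 / ((2 * n + 1 + k) * (2 * n + 2 + k)) ^ 2
        ≤ (n : ℝ) + 1 / 2 := by
      rw [div_le_iff₀ (by positivity)]
      have hn : (0 : ℝ) ≤ n := n.cast_nonneg
      have hk : (0 : ℝ) ≤ k := k.cast_nonneg
      refine mul_le_mul_of_nonneg_left ?_ (by positivity)
      calc ((n : ℝ) + k + 1 / 2) ^ 3 ≤ (2 * (n : ℝ) + 1 + k) ^ 3 :=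
          pow_le_pow_left₀ (by positivity) (by linarith) 3
        _ ≤ (2 * (n : ℝ) + 1 + k) ^ 4 := pow_le_pow_right₀ (by linarith) (by norm_num)
        _ = ((2 * (n : ℝ) + 1 + k) * (2 * n + 1 + k)) ^ 2 := by ring
        _ ≤ _ := by (gcongr; norm_num)
    calc _ ≤ C * dixonTerm (1 / 2) k * (n + 1 / 2) :=
          mul_le_mul (h k) h1 (by positivity)
            (mul_nonneg hC (dixonTerm_pos (by norm_num) k).le)
      _ = _ := by ring

lemma summable_aperyTerm (n : ℕ) : Summable (aperyTerm n) := by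
  obtain ⟨C, -, h⟩ := exists_aperyTerm_le n
  exact Summable.of_nonneg_of_le (fun k => (aperyTerm_pos n k).le) h
    (summable_dixonTerm_half.mul_left C)

lemma tendsto_mul_aperyTerm (n : ℕ) :
    Tendsto (fun k : ℕ => (k : ℝ) * aperyTerm n k) atTop (nhds 0) := by
  obtain ⟨C, -, h⟩ := exists_aperyTerm_le n
  have h1 := tendsto_mul_dixonTerm_half.const_mul C
  rw [mul_zero] at h1
  refine squeeze_zero (fun k => mul_nonneg k.cast_nonneg (aperyTerm_pos n k).le)
    (fun k => ?_) h1
  calc _ ≤ (k : ℝ) * (C * dixonTerm (1 / 2) k) :=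
        mul_le_mul_of_nonneg_left (h k) k.cast_nonneg
    _ = _ := by ring

/-- The numerator of the telescoping certificate for `aperySum_recurrence`. -/
noncomputable def aperyCert (n k : ℝ) : ℝ :=
  (9 / 32 + 31 / 16 * n + 21 / 8 * n ^ 2 - 141 / 4 * n ^ 3 - 69 / 2 * n ^ 4 + 189 * n ^ 5
    + 78 * n ^ 6 - 316 * n ^ 7)
  + (1 / 16 - n - 123 / 4 * n ^ 2 - 40 * n ^ 3 + 339 * n ^ 4 + 176 * n ^ 5 - 868 * n ^ 6) * k
  + (-3 / 8 - 25 / 4 * n - 21 * n ^ 2 + 202 * n ^ 3 + 186 * n ^ 4 - 900 * n ^ 5) * k ^ 2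
  + (1 / 2 + 44 * n ^ 2 + 112 * n ^ 3 - 408 * n ^ 4) * k ^ 3
  + (3 / 2 - 3 * n + 26 * n ^ 2 - 52 * n ^ 3) * k ^ 4
  + (-2 - 4 * n + 16 * n ^ 2) * k ^ 5
  + (-2 + 4 * n) * k ^ 6

lemma sum_aperyTerm_recurrence (m K : ℕ) :
    ∑ k ∈ Finset.range K, ((2 * (m + 1 : ℝ) + 1) ^ 2 * aperyTerm (m + 2) k
      + (44 * (m + 1 : ℝ) ^ 2 + 1) * aperyTerm (m + 1) k
      - (2 * (m + 1 : ℝ) - 1) ^ 2 * aperyTerm m k) =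
    aperyTerm m K * K * aperyCert (m + 1) K /
      ((2 * m + 1 + K) * (2 * m + 2 + K) * (2 * m + 3 + K)) ^ 2 := by
  induction K with
  | zero => simp
  | succ k ih =>
    rw [Finset.sum_range_succ, ih, aperyTerm_succ, aperyTerm_succ_left (m + 1),
      aperyTerm_succ_left]
    unfold aperyCert
    push_cast
    have h1 : 2 * ((m : ℝ) + 1) + 1 + k = 2 * m + 3 + k := by ring
    have h2 : 2 * ((m : ℝ) + 1) + 2 + k = 2 * m + 4 + k := by ring
    have h3 : 2 * (m : ℝ) + 1 + (k + 1) = 2 * m + 2 + k := by ring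
    have h4 : 2 * (m : ℝ) + 2 + (k + 1) = 2 * m + 3 + k := by ring
    have h5 : 2 * (m : ℝ) + 3 + (k + 1) = 2 * m + 4 + k := by ring
    rw [h1, h2, h3, h4, h5]
    field_simp
    ring

lemma exists_abs_sextic_le (x0 x1 x2 x3 x4 x5 x6 : ℝ) : ∃ C : ℝ, 0 ≤ C ∧ ∀ t : ℝ, 0 ≤ t →
    |x0 + x1 * t + x2 * t ^ 2 + x3 * t ^ 3 + x4 * t ^ 4 + x5 * t ^ 5 + x6 * t ^ 6| ≤
      C * (1 + t) ^ 6 := by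
  refine ⟨|x0| + |x1| + |x2| + |x3| + |x4| + |x5| + |x6|, by positivity, fun t ht => ?_⟩
  have h1 : 1 ≤ (1 + t) ^ 6 := one_le_pow₀ (by linarith)
  have hp : ∀ j : ℕ, j ≤ 6 → t ^ j ≤ (1 + t) ^ 6 := fun j hj =>
    (pow_le_pow_left₀ ht (by linarith) j).trans (pow_le_pow_right₀ (by linarith) hj)
  have hm : ∀ (x : ℝ) (j : ℕ), j ≤ 6 → |x * t ^ j| ≤ |x| * (1 + t) ^ 6 := fun x j hj => by
    rw [abs_mul, abs_of_nonneg (pow_nonneg ht j)]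
    exact mul_le_mul_of_nonneg_left (hp j hj) (abs_nonneg x)
  have m0 := hm x0 0 (by norm_num)
  have m1 := hm x1 1 (by norm_num)
  rw [pow_zero, mul_one] at m0
  rw [pow_one] at m1
  refine (abs_add_le _ _).trans ?_
  have a5 := abs_add_le (x0 + x1 * t + x2 * t ^ 2 + x3 * t ^ 3 + x4 * t ^ 4) (x5 * t ^ 5)
  have a4 := abs_add_le (x0 + x1 * t + x2 * t ^ 2 + x3 * t ^ 3) (x4 * t ^ 4)
  have a3 := abs_add_le (x0 + x1 * t + x2 * t ^ 2) (x3 * t ^ 3)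
  have a2 := abs_add_le (x0 + x1 * t) (x2 * t ^ 2)
  have a1 := abs_add_le x0 (x1 * t)
  linarith [hm x2 2 (by norm_num), hm x3 3 (by norm_num), hm x4 4 (by norm_num),
    hm x5 5 (by norm_num), hm x6 6 (by norm_num)]

lemma exists_abs_aperyCert_le (m : ℕ) : ∃ C : ℝ, ∀ k : ℕ,
    |aperyCert (m + 1) k| ≤ C * ((2 * m + 1 + k) * (2 * m + 2 + k) * (2 * m + 3 + k)) ^ 2 := by
  obtain ⟨C, hC, h⟩ : ∃ C : ℝ, 0 ≤ C ∧ ∀ t : ℝ, 0 ≤ t →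
      |aperyCert (m + 1) t| ≤ C * (1 + t) ^ 6 := exists_abs_sextic_le _ _ _ _ _ _ _
  refine ⟨C, fun k => (h k k.cast_nonneg).trans (mul_le_mul_of_nonneg_left ?_ hC)⟩
  have hm : (0 : ℝ) ≤ m := m.cast_nonneg
  have hk : (0 : ℝ) ≤ k := k.cast_nonneg
  calc (1 + (k : ℝ)) ^ 6 = ((1 + k) * (1 + k) * (1 + k)) ^ 2 := by ring
    _ ≤ _ := by gcongr <;> linarith

lemma aperyTerm_one_eq (k : ℕ) : aperyTerm 1 k = aperyTerm 0 k *
    (1 / 2 * (k + 1 / 2) ^ 3 / ((k + 1) * (k + 2)) ^ 2) := by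
  have := aperyTerm_succ_left 0 k
  push_cast at this
  simp only [mul_zero, zero_add] at this
  rw [this, add_comm (1 : ℝ) k, add_comm (2 : ℝ) k]

lemma dixonTerm_three_half (k : ℕ) : dixonTerm (3 / 2) k =
    dixonTerm (1 / 2) k * ((2 * k + 1) / (k + 1) ^ 2) := by
  induction k with
  | zero => simp [dixonTerm]
  | succ k ih =>
    rw [dixonTerm_succ, dixonTerm_succ, ih]
    push_cast
    field_simp
    ring

lemma sum_contiguous (K : ℕ) :
    ∑ k ∈ Finset.range K, (aperyTerm 1 k + 1 / 2 * aperyTerm 0 k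
      - 5 / 8 * π ^ 2 * dixonTerm (3 / 2) k) =
    - (π ^ 2 * dixonTerm (1 / 2) K) * K * (1 / 2 + 2 * K + K ^ 2) / (K + 1) ^ 2 := by
  induction K with
  | zero => simp
  | succ k ih =>
    rw [Finset.sum_range_succ, ih, aperyTerm_one_eq, aperyTerm_zero_eq, dixonTerm_three_half,
      dixonTerm_succ]
    push_cast
    field_simp
    ring

/-- The half-integral Apéry-type numbers `∑ₖ Γ(n + 1/2) Γ(n + k + 1/2)³ / (k! (2n + k)!²)`. -/
noncomputable def aperySum (n : ℕ) : ℝ := ∑' k, aperyTerm n k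

lemma aperySum_pos (n : ℕ) : 0 < aperySum n :=
  (summable_aperyTerm n).tsum_pos (fun k => (aperyTerm_pos n k).le) 0 (aperyTerm_pos n 0)

lemma aperySum_recurrence (m : ℕ) :
    (2 * (m + 1 : ℝ) + 1) ^ 2 * aperySum (m + 2) + (44 * (m + 1 : ℝ) ^ 2 + 1) * aperySum (m + 1)
      - (2 * (m + 1 : ℝ) - 1) ^ 2 * aperySum m = 0 := by
  have hs := ((((summable_aperyTerm (m + 2)).hasSum.mul_left ((2 * (m + 1 : ℝ) + 1) ^ 2)).add
    ((summable_aperyTerm (m + 1)).hasSum.mul_left (44 * (m + 1 : ℝ) ^ 2 + 1))).sub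
    ((summable_aperyTerm m).hasSum.mul_left ((2 * (m + 1 : ℝ) - 1) ^ 2))).tendsto_sum_nat
  simp_rw [sum_aperyTerm_recurrence] at hs
  refine tendsto_nhds_unique hs ?_
  obtain ⟨C, hC⟩ := exists_abs_aperyCert_le m
  have h1 := (tendsto_mul_aperyTerm m).mul_const C
  rw [zero_mul] at h1
  refine squeeze_zero_norm (fun K => ?_) h1
  rw [Real.norm_eq_abs, abs_div, abs_mul, abs_of_nonneg (mul_nonneg (aperyTerm_pos m K).le
    K.cast_nonneg), abs_of_nonneg (a := (_ : ℝ) ^ 2) (by positivity), div_le_iff₀ (by positivity),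
    mul_comm (aperyTerm m K), mul_assoc _ C]
  exact mul_le_mul_of_nonneg_left (hC K) (mul_nonneg K.cast_nonneg (aperyTerm_pos m K).le)

lemma aperySum_zero : aperySum 0 = π ^ 2 * dixonSum (1 / 2) := by
  simp only [aperySum, dixonSum, aperyTerm_zero_eq, tsum_mul_left]

lemma aperySum_one :
    aperySum 1 = -(1 / 2) * aperySum 0 + 5 / 8 * π ^ 2 * dixonSum (3 / 2) := by
  have hs := (((summable_aperyTerm 1).hasSum.add
    ((summable_aperyTerm 0).hasSum.mul_left (1 / 2))).sub
    ((summable_dixonTerm (show (1 : ℝ) / 2 ≤ 3 / 2 by norm_num)).hasSum.mul_left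
      (5 / 8 * π ^ 2))).tendsto_sum_nat
  simp_rw [sum_contiguous] at hs
  have h0 : Tendsto (fun K : ℕ => -(π ^ 2 * dixonTerm (1 / 2) K) * K * (1 / 2 + 2 * K + K ^ 2) /
      (K + 1) ^ 2) atTop (nhds 0) := by
    have h1 := tendsto_mul_dixonTerm_half.mul_const (π ^ 2)
    rw [zero_mul] at h1
    refine squeeze_zero_norm (fun K => ?_) h1
    have := (dixonTerm_pos (show (0 : ℝ) < 1 / 2 by norm_num) K).le
    rw [neg_mul, neg_mul, neg_div, norm_neg, Real.norm_eq_abs, abs_of_nonneg (by positivity),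
      div_le_iff₀ (by positivity)]
    calc _ = K * dixonTerm (1 / 2) K * π ^ 2 * (1 / 2 + 2 * K + K ^ 2) := by ring
      _ ≤ _ := by
        refine mul_le_mul_of_nonneg_left ?_ (by positivity)
        nlinarith
  have := tendsto_nhds_unique hs h0
  unfold aperySum dixonSum
  linarith

lemma Gamma_three_quarters_quot : Real.Gamma (1 / 4) ^ 2 / Real.Gamma (3 / 4) ^ 2 =
    4 / gammaQuot (1 / 4) := by
  have e : gammaQuot (1 / 4) = Real.Gamma (3 / 4) ^ 2 / (Real.Gamma (1 / 4) *
      (1 / 4 * Real.Gamma (1 / 4))) := by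
    rw [gammaQuot, Real.Gamma_add_one (by norm_num)]
    norm_num
  have p1 := Real.Gamma_pos_of_pos (show (0 : ℝ) < 1 / 4 by norm_num)
  have p2 := Real.Gamma_pos_of_pos (show (0 : ℝ) < 3 / 4 by norm_num)
  rw [e]
  field_simp

lemma gammaQuot_three_quarters : gammaQuot (3 / 4) =
    Real.Gamma (1 / 4) ^ 2 / Real.Gamma (3 / 4) ^ 2 / 12 := by
  have e : gammaQuot (3 / 4) = (1 / 4 * Real.Gamma (1 / 4)) ^ 2 / (Real.Gamma (3 / 4) *
      (3 / 4 * Real.Gamma (3 / 4))) := by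
    rw [gammaQuot, Real.Gamma_add_one (by norm_num), show (3 : ℝ) / 4 + 1 / 2 = 1 / 4 + 1 by norm_num,
      Real.Gamma_add_one (by norm_num)]
  have p2 := Real.Gamma_pos_of_pos (show (0 : ℝ) < 3 / 4 by norm_num)
  rw [e]
  field_simp
  norm_num

lemma gammaQuot_half : gammaQuot (1 / 2) = 2 / π := by
  rw [gammaQuot, Real.Gamma_add_one (by norm_num), Real.Gamma_one_half_eq]
  norm_num
  have := Real.sq_sqrt pi_pos.le
  field_simp
  exact this.symm

lemma gammaQuot_three_half : gammaQuot (3 / 2) = 8 / (3 * π) := by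
  rw [show (3 : ℝ) / 2 = 1 / 2 + 1 by norm_num, gammaQuot_add_one (by norm_num), gammaQuot_half]
  field_simp
  norm_num

lemma aperySum_zero_eq : aperySum 0 = π / 2 * (Real.Gamma (1 / 4) ^ 2 / Real.Gamma (3 / 4) ^ 2) := by
  rw [aperySum_zero, dixonSum_eq le_rfl, Gamma_three_quarters_quot, gammaQuot_half]
  have := gammaQuot_pos (show (0 : ℝ) < 1 / 4 by norm_num)
  norm_num
  field_simp
  norm_num

lemma aperySum_one_eq : aperySum 1 =
    π * (80 - (Real.Gamma (1 / 4) ^ 2 / Real.Gamma (3 / 4) ^ 2) ^ 2) /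
      (4 * (Real.Gamma (1 / 4) ^ 2 / Real.Gamma (3 / 4) ^ 2)) := by
  have p1 := Real.Gamma_pos_of_pos (show (0 : ℝ) < 1 / 4 by norm_num)
  have p2 := Real.Gamma_pos_of_pos (show (0 : ℝ) < 3 / 4 by norm_num)
  have e : (3 : ℝ) / 2 / 2 = 3 / 4 := by norm_num
  rw [aperySum_one, aperySum_zero_eq, dixonSum_eq (by norm_num), e, gammaQuot_three_quarters,
    gammaQuot_three_half]
  have : 0 < Real.Gamma (1 / 4) ^ 2 / Real.Gamma (3 / 4) ^ 2 := by positivity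
  generalize Real.Gamma (1 / 4) ^ 2 / Real.Gamma (3 / 4) ^ 2 = s at *
  field_simp
  ring

open MeasureTheory Set ProbabilityTheory in
lemma integrableOn_and_integral_beta {α β : ℝ} (hα : 0 < α) (hβ : 0 < β) :
    IntegrableOn (fun x : ℝ => x ^ (α - 1) * (1 - x) ^ (β - 1)) (Ioo 0 1) ∧
    ∫ x in Ioo (0 : ℝ) 1, x ^ (α - 1) * (1 - x) ^ (β - 1) = beta α β := by
  have hc := Complex.betaIntegral_convergent (u := α) (v := β) (by simpa) (by simpa)
  rw [intervalIntegrable_iff_integrableOn_Ioo_of_le (by simp)] at hc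
  have hre : EqOn (fun x : ℝ => RCLike.re ((x : ℂ) ^ ((α : ℂ) - 1) * (1 - (x : ℂ)) ^ ((β : ℂ) - 1)))
      (fun x : ℝ => x ^ (α - 1) * (1 - x) ^ (β - 1)) (Ioo 0 1) := by
    intro x ⟨hx1, hx2⟩
    norm_cast
    simp only
    rw [← Complex.ofReal_cpow hx1.le, ← Complex.ofReal_cpow (by linarith), ← Complex.ofReal_mul]
    rfl
  refine ⟨(integrableOn_congr_fun hre measurableSet_Ioo).1 (Integrable.re hc), ?_⟩
  rw [beta_eq_betaIntegralReal α β hα hβ, Complex.betaIntegral,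
    intervalIntegral.integral_of_le (by norm_num), integral_Ioc_eq_integral_Ioo,
    ← RCLike.re_to_complex, ← integral_re hc]
  exact (setIntegral_congr_fun measurableSet_Ioo hre).symm

lemma hasSum_multichoose_mul_pow (a : ℝ) {x : ℝ} (hx0 : 0 ≤ x) (hx1 : x < 1) :
    HasSum (fun k => Ring.multichoose a k * x ^ k) (1 / (1 - x) ^ a) := by
  have h := (Real.one_div_one_sub_rpow_hasFPowerSeriesOnBall_zero a).hasSum (y := x)
    (by simpa [Real.enorm_eq_ofReal hx0] using hx1)
  simp only [zero_add, FormalMultilinearSeries.ofScalars_apply_eq, smul_eq_mul] at h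
  simpa only [Ring.multichoose_eq] using h

lemma multichoose_succ (a : ℝ) (k : ℕ) :
    Ring.multichoose a (k + 1) = Ring.multichoose a k * ((a + k) / (k + 1)) := by
  have h1 := Ring.factorial_nsmul_multichoose_eq_ascPochhammer a k
  have h2 := Ring.factorial_nsmul_multichoose_eq_ascPochhammer a (k + 1)
  rw [ascPochhammer_succ_right, Polynomial.smeval_mul, ← h1] at h2
  simp [Polynomial.smeval_add, Polynomial.smeval_natCast, Nat.factorial_succ] at h2
  have := Nat.factorial_ne_zero k
  have : (k.factorial : ℝ) ≠ 0 := by exact_mod_cast this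
  field_simp
  apply mul_left_cancel₀ this
  linear_combination h2

open ProbabilityTheory in
lemma aperyTerm_eq_multichoose_mul_beta_sq (n k : ℕ) : aperyTerm n k =
    Ring.multichoose ((n : ℝ) + 1 / 2) k * beta (n + 1 / 2 + k) (n + 1 / 2) ^ 2 := by
  induction k with
  | zero =>
    have : Real.Gamma ((n : ℝ) + 1 / 2 + ((0 : ℕ) : ℝ) + (n + 1 / 2)) = ((2 * n).factorial : ℝ) := by
      rw [← Real.Gamma_nat_eq_factorial]; congr 1; push_cast; ring
    rw [beta, this]
    simp [aperyTerm]
    ring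
  | succ k ih =>
    have h1 : Real.Gamma ((n : ℝ) + 1 / 2 + ((k + 1 : ℕ) : ℝ)) =
        (n + 1 / 2 + k) * Real.Gamma ((n : ℝ) + 1 / 2 + k) := by
      rw [← Real.Gamma_add_one (by positivity)]; congr 1; push_cast; ring
    have h2 : Real.Gamma ((n : ℝ) + 1 / 2 + ((k + 1 : ℕ) : ℝ) + (n + 1 / 2)) =
        (2 * n + 1 + k) * Real.Gamma ((n : ℝ) + 1 / 2 + k + (n + 1 / 2)) := by
      rw [show (2 * n + 1 + k : ℝ) = (n : ℝ) + 1 / 2 + k + (n + 1 / 2) by ring,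
        ← Real.Gamma_add_one (by positivity)]; congr 1; push_cast; ring
    rw [aperyTerm_succ, ih, beta, beta, h1, h2, multichoose_succ]
    have : Real.Gamma ((n : ℝ) + 1 / 2 + k + (n + 1 / 2)) ≠ 0 :=
      (Real.Gamma_pos_of_pos (by positivity)).ne'
    field_simp
    ring

open MeasureTheory Set ProbabilityTheory in
lemma aperySum_eq_integral (n : ℕ) : aperySum n =
    ∫ z in Ioo (0 : ℝ) 1 ×ˢ Ioo (0 : ℝ) 1,
      z.1 ^ (n - 1 / 2 : ℝ) * (1 - z.1) ^ (n - 1 / 2 : ℝ) *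
      (z.2 ^ (n - 1 / 2 : ℝ) * (1 - z.2) ^ (n - 1 / 2 : ℝ)) / (1 - z.1 * z.2) ^ (n + 1 / 2 : ℝ) := by
  set w : ℕ → ℝ → ℝ := fun k x =>
    x ^ ((n + 1 / 2 + k : ℝ) - 1) * (1 - x) ^ ((n + 1 / 2 : ℝ) - 1) with hw
  have hwi (k : ℕ) := integrableOn_and_integral_beta (α := n + 1 / 2 + k) (β := n + 1 / 2)
    (by positivity) (by positivity)
  set F : ℕ → ℝ × ℝ → ℝ := fun k z => Ring.multichoose ((n : ℝ) + 1 / 2) k * (w k z.1 * w k z.2)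
  have hμ : (volume : Measure (ℝ × ℝ)).restrict (Ioo (0 : ℝ) 1 ×ˢ Ioo (0 : ℝ) 1) =
      (volume.restrict (Ioo (0 : ℝ) 1)).prod (volume.restrict (Ioo (0 : ℝ) 1)) := by
    rw [Measure.prod_restrict]; rfl
  have hmc (k : ℕ) : 0 ≤ Ring.multichoose ((n : ℝ) + 1 / 2) k := by
    have h := aperyTerm_pos n k
    rw [aperyTerm_eq_multichoose_mul_beta_sq] at h
    exact (pos_of_mul_pos_left h (sq_nonneg _)).le
  have hFi (k : ℕ) : ∫ z in Ioo (0 : ℝ) 1 ×ˢ Ioo (0 : ℝ) 1, F k z = aperyTerm n k := by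
    rw [hμ, integral_const_mul, integral_prod_mul, aperyTerm_eq_multichoose_mul_beta_sq, ← (hwi k).2]
    ring
  have hFn (k : ℕ) : ∫ z in Ioo (0 : ℝ) 1 ×ˢ Ioo (0 : ℝ) 1, ‖F k z‖ = aperyTerm n k := by
    rw [← hFi]
    refine setIntegral_congr_fun (measurableSet_Ioo.prod measurableSet_Ioo) fun z hz => ?_
    obtain ⟨⟨h1, h2⟩, h3, h4⟩ := hz
    have h5 : 0 < 1 - z.1 := by linarith
    have h6 : 0 < 1 - z.2 := by linarith
    have := hmc k
    apply Real.norm_of_nonneg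
    simp only [F, hw]
    positivity
  have hFint (k : ℕ) : Integrable (F k)
      ((volume : Measure (ℝ × ℝ)).restrict (Ioo (0 : ℝ) 1 ×ˢ Ioo (0 : ℝ) 1)) := by
    rw [hμ]
    exact ((hwi k).1.mul_prod (hwi k).1).const_mul _
  have hs := hasSum_integral_of_summable_integral_norm hFint
    (by simp only [hFn]; exact summable_aperyTerm n)
  simp only [hFi] at hs
  rw [aperySum, hs.tsum_eq]
  refine setIntegral_congr_fun (measurableSet_Ioo.prod measurableSet_Ioo) fun z hz => ?_
  obtain ⟨⟨h1, h2⟩, h3, h4⟩ := hz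
  have h := (hasSum_multichoose_mul_pow ((n : ℝ) + 1 / 2) (x := z.1 * z.2) (by positivity)
    (by nlinarith)).mul_left (z.1 ^ (n - 1 / 2 : ℝ) * (1 - z.1) ^ (n - 1 / 2 : ℝ) *
      (z.2 ^ (n - 1 / 2 : ℝ) * (1 - z.2) ^ (n - 1 / 2 : ℝ)))
  rw [← mul_one_div, ← h.tsum_eq]
  refine tsum_congr fun k => ?_
  simp only [F, hw]
  rw [show (n + 1 / 2 + k : ℝ) - 1 = (n - 1 / 2 : ℝ) + k by ring,
    show (n + 1 / 2 : ℝ) - 1 = (n - 1 / 2 : ℝ) by ring, Real.rpow_add h1, Real.rpow_add h3,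
    Real.rpow_natCast, Real.rpow_natCast, mul_pow]
  ring

/-- The base of the power in the double integral for `aperySum`. -/
noncomputable def aperyKernel (z : ℝ × ℝ) : ℝ :=
  z.1 * (1 - z.1) * (z.2 * (1 - z.2)) / (1 - z.1 * z.2)

/-- The slowly varying factor in the double integral for `aperySum`. -/
noncomputable def aperyWeight (z : ℝ × ℝ) : ℝ :=
  (z.1 * (1 - z.1) * (z.2 * (1 - z.2))) ^ (3 / 2 : ℝ) / (1 - z.1 * z.2) ^ (5 / 2 : ℝ)

lemma aperyKernel_le {r x y : ℝ} (hr0 : 0 < r) (hr : r ^ 2 = 1 - r) (hx : x ∈ Set.Ioo (0 : ℝ) 1)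
    (hy : y ∈ Set.Ioo (0 : ℝ) 1) :
    aperyKernel (x, y) ≤ r ^ 5 * (1 - ((x - r) ^ 2 + (y - r) ^ 2) / 512) := by
  have hr1 : 3 / 5 < r := by nlinarith
  have hr2 : r < 2 / 3 := by nlinarith
  obtain ⟨hx0, hx1⟩ := hx
  obtain ⟨hy0, hy1⟩ := hy
  obtain ⟨a, ha0, rfl⟩ : ∃ a : ℝ, 0 < a ∧ a ^ 2 = x := ⟨√x, Real.sqrt_pos.2 hx0, Real.sq_sqrt hx0.le⟩
  obtain ⟨b, hb0, rfl⟩ : ∃ b : ℝ, 0 < b ∧ b ^ 2 = y := ⟨√y, Real.sqrt_pos.2 hy0, Real.sq_sqrt hy0.le⟩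
  have ha1 : a < 1 := by nlinarith
  have hb1 : b < 1 := by nlinarith
  have hab0 : 0 < a * b := by positivity
  have hab1 : a * b < 1 := by nlinarith
  have hker : aperyKernel (a ^ 2, b ^ 2) ≤
      (a * b) ^ 2 * (1 - a * b) / (1 + a * b) - (a * b) ^ 2 * (a - b) ^ 2 := by
    have h1 : aperyKernel (a ^ 2, b ^ 2) = (a * b) ^ 2 * (1 - a * b) / (1 + a * b) -
        (a * b) ^ 2 * (a - b) ^ 2 / (1 - (a * b) ^ 2) := by
      have : 1 - a ^ 2 * b ^ 2 ≠ 0 := by nlinarith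
      have h2 : 1 - (a * b) ^ 2 ≠ 0 := by rw [mul_pow]; exact this
      have : 1 + a * b ≠ 0 := by positivity
      rw [aperyKernel]
      simp only
      field_simp
      ring
    have h3 : (a * b) ^ 2 * (a - b) ^ 2 ≤ (a * b) ^ 2 * (a - b) ^ 2 / (1 - (a * b) ^ 2) := by
      rw [le_div_iff₀ (by nlinarith)]
      have : 0 ≤ (a * b) ^ 2 * (a - b) ^ 2 * (a * b) ^ 2 := by positivity
      nlinarith
    linarith
  have hmax : (a * b) ^ 2 * (1 - a * b) / (1 + a * b) ≤ r ^ 5 - (a * b - r) ^ 2 / 16 := by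
    rw [div_le_iff₀ (by positivity)]
    have h3 : r ^ 3 = 2 * r - 1 := by linear_combination (r - 1) * hr
    have h5 : r ^ 5 = 5 * r - 3 := by linear_combination (r ^ 3 - r ^ 2 + 2 * r - 3) * hr
    have h4 : (r ^ 5 - (a * b - r) ^ 2 / 16) * (1 + a * b) - (a * b) ^ 2 * (1 - a * b) =
        (a * b - r) ^ 2 * (a * b + (2 * r - 1) - (1 + a * b) / 16) := by
      rw [h5]
      linear_combination (-2 * r + 3 + 3 * (a * b)) * hr
    have h6 : 0 ≤ (a * b - r) ^ 2 * (a * b + (2 * r - 1) - (1 + a * b) / 16) :=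
      mul_nonneg (sq_nonneg _) (by linarith)
    linarith
  have hxd : (a ^ 2 - r) ^ 2 ≤ 2 * (a - b) ^ 2 + 2 * (a * b - r) ^ 2 := by
    have h1 : a ^ 2 * (a - b) ^ 2 ≤ (a - b) ^ 2 := mul_le_of_le_one_left (sq_nonneg _) hx1.le
    have h2 : (a ^ 2 - r) ^ 2 = 2 * (a ^ 2 * (a - b) ^ 2) + 2 * (a * b - r) ^ 2 -
        (a * (a - b) - (a * b - r)) ^ 2 := by ring
    linarith [sq_nonneg (a * (a - b) - (a * b - r))]
  have hyd : (b ^ 2 - r) ^ 2 ≤ 2 * (a - b) ^ 2 + 2 * (a * b - r) ^ 2 := by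
    have h1 : b ^ 2 * (a - b) ^ 2 ≤ (a - b) ^ 2 := mul_le_of_le_one_left (sq_nonneg _) hy1.le
    have h2 : (b ^ 2 - r) ^ 2 = 2 * (b ^ 2 * (a - b) ^ 2) + 2 * (a * b - r) ^ 2 -
        (b * (b - a) - (a * b - r)) ^ 2 := by ring
    linarith [sq_nonneg (b * (b - a) - (a * b - r))]
  have hd : (a * b) ^ 2 * (a - b) ^ 2 + (a * b - r) ^ 2 / 16 ≥
      ((a ^ 2 - r) ^ 2 + (b ^ 2 - r) ^ 2) / 512 := by
    rcases le_total (r / 2) (a * b) with h | h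
    · have h1 : 1 / 16 ≤ (a * b) ^ 2 :=
        le_trans (by norm_num) (pow_le_pow_left₀ (a := 1 / 4) (by norm_num) (by linarith) 2)
      linarith [mul_le_mul_of_nonneg_right h1 (sq_nonneg (a - b)), sq_nonneg (a - b),
        sq_nonneg (a * b - r)]
    · have h1 : 1 / 16 ≤ (a * b - r) ^ 2 := by
        rw [← neg_sub, neg_sq]
        exact le_trans (by norm_num) (pow_le_pow_left₀ (a := 1 / 4) (by norm_num) (by linarith) 2)
      have h2 : (a ^ 2 - r) ^ 2 ≤ 1 := by
        have : |a ^ 2 - r| ≤ 1 := abs_le.2 ⟨by linarith, by linarith⟩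
        exact (sq_le_one_iff_abs_le_one _).2 this
      have h3 : (b ^ 2 - r) ^ 2 ≤ 1 := by
        have : |b ^ 2 - r| ≤ 1 := abs_le.2 ⟨by linarith, by linarith⟩
        exact (sq_le_one_iff_abs_le_one _).2 this
      have : 0 ≤ (a * b) ^ 2 * (a - b) ^ 2 := by positivity
      linarith
  have hr5 : r ^ 5 * (((a ^ 2 - r) ^ 2 + (b ^ 2 - r) ^ 2) / 512) ≤
      ((a ^ 2 - r) ^ 2 + (b ^ 2 - r) ^ 2) / 512 :=
    mul_le_of_le_one_left (by positivity) (pow_le_one₀ hr0.le (by linarith))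
  linarith

lemma aperyWeight_le_one {x y : ℝ} (hx : x ∈ Set.Ioo (0 : ℝ) 1) (hy : y ∈ Set.Ioo (0 : ℝ) 1) :
    aperyWeight (x, y) ≤ 1 := by
  obtain ⟨hx0, hx1⟩ := hx
  obtain ⟨hy0, hy1⟩ := hy
  have h1 : 0 < 1 - x := by linarith
  have h2 : 0 < 1 - y := by linarith
  have h3 : 0 < 1 - x * y := by nlinarith
  have h4 : x * (1 - x) * (y * (1 - y)) ≤ (1 - x * y) ^ (2 : ℝ) := by
    rw [Real.rpow_two]
    have h5 : (1 - x) * (1 - y) ≤ (1 - x * y) * (1 - x * y) :=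
      mul_le_mul (by nlinarith) (by nlinarith) h2.le h3.le
    have h6 : x * y * ((1 - x) * (1 - y)) ≤ (1 - x) * (1 - y) :=
      mul_le_of_le_one_left (by positivity) (by nlinarith)
    nlinarith
  rw [aperyWeight]
  refine div_le_one_of_le₀ ?_ (by positivity)
  calc (x * (1 - x) * (y * (1 - y))) ^ (3 / 2 : ℝ)
      ≤ ((1 - x * y) ^ (2 : ℝ)) ^ (3 / 2 : ℝ) :=
        Real.rpow_le_rpow (by positivity) h4 (by norm_num)
    _ = (1 - x * y) ^ (3 : ℝ) := by rw [← Real.rpow_mul h3.le]; norm_num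
    _ ≤ (1 - x * y) ^ (5 / 2 : ℝ) :=
        Real.rpow_le_rpow_of_exponent_ge h3 (by nlinarith) (by norm_num)

open MeasureTheory Set in
lemma aperySum_add_two_eq_integral (N : ℕ) : aperySum (N + 2) =
    ∫ z in Ioo (0 : ℝ) 1 ×ˢ Ioo (0 : ℝ) 1, aperyKernel z ^ N * aperyWeight z := by
  rw [aperySum_eq_integral]
  refine setIntegral_congr_fun (measurableSet_Ioo.prod measurableSet_Ioo) fun z hz => ?_
  obtain ⟨⟨h1, h2⟩, h3, h4⟩ := hz
  have h5 : 0 < 1 - z.1 := by linarith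
  have h6 : 0 < 1 - z.2 := by linarith
  have h7 : 0 < 1 - z.1 * z.2 := by nlinarith
  simp only [aperyKernel, aperyWeight]
  rw [← Real.mul_rpow h1.le h5.le, ← Real.mul_rpow h3.le h6.le,
    ← Real.mul_rpow (by positivity) (by positivity),
    show (((N + 2 : ℕ) : ℝ) - 1 / 2) = N + 3 / 2 by push_cast; ring,
    show (((N + 2 : ℕ) : ℝ) + 1 / 2) = N + 5 / 2 by push_cast; ring,
    Real.rpow_add (by positivity), Real.rpow_add h7, Real.rpow_natCast, Real.rpow_natCast, div_pow,
    mul_div_mul_comm]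

open MeasureTheory in
lemma integrable_exp_neg_mul_sq_add_sq {b : ℝ} (hb : 0 < b) :
    Integrable (fun w : ℝ × ℝ => Real.exp (-b * (w.1 ^ 2 + w.2 ^ 2))) := by
  have h := (integrable_exp_neg_mul_sq hb).mul_prod (integrable_exp_neg_mul_sq hb)
  refine h.congr (Filter.Eventually.of_forall fun w => ?_)
  simp only
  rw [← Real.exp_add]
  ring_nf

open MeasureTheory in
lemma integral_exp_neg_quadratic {A B : ℝ} (hB : 0 ≤ B) (hAB : B < 2 * A) :
    ∫ w : ℝ × ℝ, Real.exp (-(A * w.1 ^ 2 - B * (w.1 * w.2) + A * w.2 ^ 2)) =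
      2 * π / √(4 * A ^ 2 - B ^ 2) := by
  have hA : 0 < A := by linarith
  have hi : Integrable (fun w : ℝ × ℝ =>
      Real.exp (-(A * w.1 ^ 2 - B * (w.1 * w.2) + A * w.2 ^ 2))) := by
    refine (integrable_exp_neg_mul_sq_add_sq (b := A - B / 2) (by linarith)).mono'
      (by fun_prop) (Filter.Eventually.of_forall fun w => ?_)
    rw [Real.norm_of_nonneg (Real.exp_pos _).le, Real.exp_le_exp]
    nlinarith [mul_nonneg hB (sq_nonneg (w.1 - w.2))]
  rw [Measure.volume_eq_prod] at hi ⊢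
  rw [integral_prod _ hi]
  have h1 (x : ℝ) : ∫ y : ℝ, Real.exp (-(A * x ^ 2 - B * (x * y) + A * y ^ 2)) =
      Real.exp (-(A - B ^ 2 / (4 * A)) * x ^ 2) * √(π / A) := by
    rw [← integral_gaussian, ← integral_add_right_eq_self _ (B * x / (2 * A)),
      ← integral_const_mul]
    congr 1
    ext y
    rw [← Real.exp_add]
    congr 1
    field_simp
    ring
  simp only [h1]
  rw [integral_mul_const, integral_gaussian]
  have h2 : 0 < 4 * A ^ 2 - B ^ 2 := by nlinarith
  have h3 : A - B ^ 2 / (4 * A) = (4 * A ^ 2 - B ^ 2) / (4 * A) := by field_simp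
  rw [h3, ← Real.sqrt_mul (by positivity), eq_div_iff (by positivity),
    ← Real.sqrt_mul (by positivity), Real.sqrt_eq_iff_mul_self_eq (by positivity) (by positivity)]
  field_simp
  ring

lemma tendsto_mul_aperyKernel_sub_one {r : ℝ} (hr0 : 0 < r) (hr : r ^ 2 = 1 - r) (u v : ℝ) :
    Tendsto (fun N : ℕ => (N : ℝ) *
      (aperyKernel (r + (√N)⁻¹ * u, r + (√N)⁻¹ * v) / r ^ 5 - 1)) atTop
      (nhds (-((r ^ 3)⁻¹ * u ^ 2 - (r ^ 2)⁻¹ * (u * v) + (r ^ 3)⁻¹ * v ^ 2))) := by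
  have he : Tendsto (fun N : ℕ => (√(N : ℝ))⁻¹) atTop (nhds 0) :=
    (Real.tendsto_sqrt_atTop.comp tendsto_natCast_atTop_atTop).inv_tendsto_atTop
  have hrr : 1 - r * r ≠ 0 := by nlinarith
  have hden : Tendsto (fun N : ℕ => 1 - (r + (√(N : ℝ))⁻¹ * u) * (r + (√(N : ℝ))⁻¹ * v)) atTop
      (nhds (1 - r * r)) := by
    have h : Continuous fun e : ℝ => 1 - (r + e * u) * (r + e * v) := by fun_prop
    simpa [Function.comp_def] using (h.tendsto 0).comp he
  have hnum : Tendsto (fun N : ℕ => -r ^ 3 * (u ^ 2 + v ^ 2) + (r ^ 6 + r ^ 5) * (u * v)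
      + (√(N : ℝ))⁻¹ * (r ^ 3 * u * v * (u + v)) + ((√(N : ℝ))⁻¹) ^ 2 * (u * v) ^ 2) atTop
      (nhds (-r ^ 3 * (u ^ 2 + v ^ 2) + (r ^ 6 + r ^ 5) * (u * v))) := by
    have h : Continuous fun e : ℝ => -r ^ 3 * (u ^ 2 + v ^ 2) + (r ^ 6 + r ^ 5) * (u * v)
      + e * (r ^ 3 * u * v * (u + v)) + e ^ 2 * (u * v) ^ 2 := by fun_prop
    simpa [Function.comp_def] using (h.tendsto 0).comp he
  have hlim := hnum.div (hden.const_mul (r ^ 5)) (mul_ne_zero (by positivity) hrr)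
  have hval : (-r ^ 3 * (u ^ 2 + v ^ 2) + (r ^ 6 + r ^ 5) * (u * v)) / (r ^ 5 * (1 - r * r)) =
      -((r ^ 3)⁻¹ * u ^ 2 - (r ^ 2)⁻¹ * (u * v) + (r ^ 3)⁻¹ * v ^ 2) := by
    rw [show 1 - r * r = r by linear_combination -hr,
      show r ^ 6 + r ^ 5 = r ^ 4 by linear_combination r ^ 4 * hr]
    field_simp
    ring
  rw [hval] at hlim
  refine hlim.congr' ?_
  filter_upwards [hden.eventually_ne hrr, eventually_gt_atTop 0] with N hN hN0
  have hN0' : (0 : ℝ) < N := by exact_mod_cast hN0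
  have hs : (N : ℝ) * ((√(N : ℝ))⁻¹) ^ 2 = 1 := by
    rw [inv_pow, Real.sq_sqrt hN0'.le, mul_inv_cancel₀ hN0'.ne']
  simp only [aperyKernel, Pi.div_apply]
  generalize (√(N : ℝ))⁻¹ = e at *
  rw [div_div, div_sub_one (mul_ne_zero hN (by positivity)), mul_div_assoc', mul_comm (r ^ 5)]
  congr 1
  have hfac (t : ℝ) : (r + e * t) * (1 - (r + e * t)) = r ^ 3 - r ^ 3 * (e * t) - (e * t) ^ 2 := by
    linear_combination (-r + (r - 1) * (e * t)) * hr
  rw [hfac, hfac]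
  linear_combination (-(-r ^ 3 * (u ^ 2 + v ^ 2) + (r ^ 6 + r ^ 5) * (u * v)
    + e * (r ^ 3 * u * v * (u + v)) + e ^ 2 * (u * v) ^ 2)) * hs - N * r ^ 5 * hr

open MeasureTheory Set in
lemma tendsto_mul_aperySum_add_two {r : ℝ} (hr0 : 0 < r) (hr : r ^ 2 = 1 - r) :
    Tendsto (fun N : ℕ => (N : ℝ) * (aperySum (N + 2) / (r ^ 5) ^ N)) atTop
      (nhds (2 * π / √(4 * (r ^ 3)⁻¹ ^ 2 - (r ^ 2)⁻¹ ^ 2) * aperyWeight (r, r))) := by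
  have hr1 : r < 1 := by nlinarith
  set U : Set (ℝ × ℝ) := Ioo (0 : ℝ) 1 ×ˢ Ioo (0 : ℝ) 1 with hU
  have hUm : MeasurableSet U := measurableSet_Ioo.prod measurableSet_Ioo
  set G : ℕ → ℝ × ℝ → ℝ := fun N => U.indicator fun z => (aperyKernel z / r ^ 5) ^ N * aperyWeight z
    with hG
  have hGm (N : ℕ) : Measurable (G N) := by
    refine Measurable.indicator ?_ hUm
    unfold aperyKernel aperyWeight
    fun_prop
  have hGi (N : ℕ) : ∫ z, G N z = aperySum (N + 2) / (r ^ 5) ^ N := by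
    rw [aperySum_add_two_eq_integral, integral_indicator hUm, ← integral_div]
    congr 1
    ext z
    rw [div_pow, div_mul_eq_mul_div]
  have hscale : ∀ᶠ N : ℕ in atTop, ∫ w : ℝ × ℝ, G N ((r, r) + (√(N : ℝ))⁻¹ • w) =
      (N : ℝ) * (aperySum (N + 2) / (r ^ 5) ^ N) := by
    filter_upwards [eventually_gt_atTop 0] with N hN
    have hN' : (0 : ℝ) < N := by exact_mod_cast hN
    rw [Measure.integral_comp_smul volume (fun z => G N ((r, r) + z)), integral_add_left_eq_self,
      hGi, Module.finrank_prod, Module.finrank_self, smul_eq_mul]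
    congr 1
    rw [← inv_pow, inv_inv, Real.sq_sqrt hN'.le, abs_of_pos hN']
  refine Tendsto.congr' hscale ?_
  have hlimval : 2 * π / √(4 * (r ^ 3)⁻¹ ^ 2 - (r ^ 2)⁻¹ ^ 2) * aperyWeight (r, r) =
      ∫ w : ℝ × ℝ, Real.exp (-((r ^ 3)⁻¹ * w.1 ^ 2 - (r ^ 2)⁻¹ * (w.1 * w.2) +
        (r ^ 3)⁻¹ * w.2 ^ 2)) * aperyWeight (r, r) := by
    rw [integral_mul_const, integral_exp_neg_quadratic (by positivity)]
    have h1 : (r ^ 2)⁻¹ ≤ (r ^ 3)⁻¹ :=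
      inv_anti₀ (by positivity) (pow_le_pow_of_le_one hr0.le hr1.le (by norm_num))
    have h2 : 0 < (r ^ 3)⁻¹ := by positivity
    linarith
  rw [hlimval]
  refine tendsto_integral_filter_of_dominated_convergence
    (fun w : ℝ × ℝ => Real.exp (-(1 / 512) * (w.1 ^ 2 + w.2 ^ 2))) ?_ ?_
    (integrable_exp_neg_mul_sq_add_sq (by norm_num)) ?_
  · exact Eventually.of_forall fun N => ((hGm N).comp (by fun_prop)).aestronglyMeasurable
  · filter_upwards [eventually_gt_atTop 0] with N hN
    have hN' : (0 : ℝ) < N := by exact_mod_cast hN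
    refine Eventually.of_forall fun w => ?_
    have hs : (N : ℝ) * ((√(N : ℝ))⁻¹) ^ 2 = 1 := by
      rw [inv_pow, Real.sq_sqrt hN'.le, mul_inv_cancel₀ hN'.ne']
    by_cases hz : (r, r) + (√(N : ℝ))⁻¹ • w ∈ U
    · rw [hG]
      simp only
      rw [indicator_of_mem hz]
      have hd : ((r, r) + (√(N : ℝ))⁻¹ • w).1 - r = (√(N : ℝ))⁻¹ * w.1 := by simp
      have hd' : ((r, r) + (√(N : ℝ))⁻¹ • w).2 - r = (√(N : ℝ))⁻¹ * w.2 := by simp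
      generalize (r, r) + (√(N : ℝ))⁻¹ • w = z at *
      obtain ⟨x, y⟩ := z
      obtain ⟨hx, hy⟩ := hz
      simp only at hx hy hd hd'
      have hk := aperyKernel_le hr0 hr hx hy
      rw [hd, hd'] at hk
      have hx' : 0 < 1 - x := by linarith [hx.2]
      have hy' : 0 < 1 - y := by linarith [hy.2]
      have hxy : 0 < 1 - x * y := by nlinarith [hx.1, hy.1]
      have := hx.1
      have := hy.1
      have hk0 : 0 ≤ aperyKernel (x, y) := by rw [aperyKernel]; positivity
      have hw0 : 0 ≤ aperyWeight (x, y) := by rw [aperyWeight]; positivity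
      rw [Real.norm_of_nonneg (by positivity)]
      refine (mul_le_of_le_one_right (by positivity) (aperyWeight_le_one hx hy)).trans ?_
      have hk2 : aperyKernel (x, y) / r ^ 5 ≤
          Real.exp (-(((√(N : ℝ))⁻¹ * w.1) ^ 2 + ((√(N : ℝ))⁻¹ * w.2) ^ 2) / 512) := by
        rw [div_le_iff₀' (by positivity)]
        refine hk.trans (mul_le_mul_of_nonneg_left ?_ (by positivity))
        refine le_trans (le_of_eq ?_) (Real.add_one_le_exp _)
        ring
      refine (pow_le_pow_left₀ (by positivity) hk2 N).trans (le_of_eq ?_)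
      rw [← Real.exp_nat_mul]
      congr 1
      linear_combination (-(w.1 ^ 2 + w.2 ^ 2) / 512) * hs
    · rw [hG]
      simp only
      rw [indicator_of_notMem hz, norm_zero]
      positivity
  · refine Eventually.of_forall fun w => ?_
    have he : Tendsto (fun N : ℕ => (√(N : ℝ))⁻¹) atTop (nhds 0) :=
      (Real.tendsto_sqrt_atTop.comp tendsto_natCast_atTop_atTop).inv_tendsto_atTop
    have hz : Tendsto (fun N : ℕ => (r, r) + (√(N : ℝ))⁻¹ • w) atTop (nhds (r, r)) := by
      simpa using (he.smul_const w).const_add (r, r)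
    have hU' : ∀ᶠ N : ℕ in atTop, (r, r) + (√(N : ℝ))⁻¹ • w ∈ U :=
      hz.eventually_mem ((isOpen_Ioo.prod isOpen_Ioo).mem_nhds ⟨⟨hr0, hr1⟩, ⟨hr0, hr1⟩⟩)
    have hwc : ContinuousAt aperyWeight (r, r) := by
      have h1 : 0 < 1 - r := by linarith
      have h2 : 0 < 1 - r * r := by nlinarith
      unfold aperyWeight
      refine ContinuousAt.div ?_ ?_ (Real.rpow_pos_of_pos h2 _).ne'
      · exact ContinuousAt.rpow_const (by fun_prop) (Or.inr (by norm_num))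
      · exact ContinuousAt.rpow_const (by fun_prop) (Or.inr (by norm_num))
    have hpow := Real.tendsto_one_add_pow_exp_of_tendsto
      (tendsto_mul_aperyKernel_sub_one hr0 hr w.1 w.2)
    refine (hpow.mul (hwc.tendsto.comp hz)).congr' ?_
    filter_upwards [hU'] with N hN
    rw [hG]
    simp only [Function.comp_apply]
    rw [indicator_of_mem hN, add_sub_cancel]
    rfl

lemma exists_tendsto_mul_aperySum {r : ℝ} (hr0 : 0 < r) (hr : r ^ 2 = 1 - r) :
    ∃ c : ℝ, 0 < c ∧ c ^ 2 = 4 * π ^ 2 / (2 * r + 1) ∧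
      Tendsto (fun n : ℕ => (n : ℝ) * (aperySum n / (r ^ 5) ^ n)) atTop (nhds c) := by
  have hr1 : r < 1 := by nlinarith
  have hdisc : 4 * (r ^ 3)⁻¹ ^ 2 - (r ^ 2)⁻¹ ^ 2 = (2 * r + 1) / r ^ 7 := by
    field_simp
    linear_combination (1 - r) * hr
  have hw : aperyWeight (r, r) ^ 2 = r ^ 13 := by
    have h1 : r * (1 - r) * (r * (1 - r)) = r ^ 6 := by rw [← hr]; ring
    have h2 : 1 - r * r = r := by linear_combination -hr
    rw [aperyWeight, h1, h2, div_pow, ← Real.rpow_mul_natCast (by positivity),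
      ← Real.rpow_mul_natCast hr0.le, div_eq_iff (by positivity)]
    norm_num
    ring
  have hw0 : 0 < aperyWeight (r, r) := by
    have h1 : 0 < 1 - r := by linarith
    have h2 : 0 < 1 - r * r := by nlinarith
    rw [aperyWeight]
    positivity
  have hT := tendsto_mul_aperySum_add_two hr0 hr
  rw [hdisc] at hT
  set L := 2 * π / √((2 * r + 1) / r ^ 7) * aperyWeight (r, r) with hL
  refine ⟨L / r ^ 10, by positivity, ?_, ?_⟩
  · rw [hL, div_pow, mul_pow, div_pow, Real.sq_sqrt (by positivity), hw]
    field_simp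
    ring
  · rw [← tendsto_add_atTop_iff_nat 2]
    have h1 : Tendsto (fun N : ℕ => 1 + 2 / (N : ℝ)) atTop (nhds (1 + 0)) :=
      (tendsto_const_div_atTop_nhds_zero_nat 2).const_add 1
    have h2 := (hT.mul h1).div_const (r ^ 10)
    rw [add_zero, mul_one] at h2
    refine h2.congr' ?_
    filter_upwards [eventually_gt_atTop 0] with N hN
    have hN' : (0 : ℝ) < N := by exact_mod_cast hN
    push_cast
    rw [pow_add]
    field_simp

lemma tendsto_of_affine_recurrence {y ρ : ℕ → ℝ} {a b B : ℝ} (hb0 : 0 ≤ b) (hb1 : b < 1)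
    (hB : ∀ n, |y n| ≤ B) (hy : ∀ n, y (n + 1) = a - ρ n * y n)
    (hρ : Tendsto ρ atTop (nhds b)) : Tendsto y atTop (nhds (a / (1 + b))) := by
  have hδ : Tendsto (fun n => |b - ρ n| * B) atTop (nhds 0) := by
    simpa using ((hρ.const_sub b).abs).mul_const B
  rw [Metric.tendsto_atTop]
  intro ε hε
  have hb1' : 0 < 1 - b := by linarith
  obtain ⟨N, hN⟩ := eventually_atTop.1 (hδ.eventually_le_const
    (show (0 : ℝ) < ε / 2 * (1 - b) by positivity))
  set L := a / (1 + b) with hL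
  have hLa : L * (1 + b) = a := by rw [hL]; field_simp
  have hstep (m : ℕ) : |y (N + m) - L| ≤ b ^ m * |y N - L| + ε / 2 := by
    induction m with
    | zero => simp; positivity
    | succ m ih =>
      have h1 : y (N + (m + 1)) - L = -(b * (y (N + m) - L)) + (b - ρ (N + m)) * y (N + m) := by
        rw [← add_assoc, hy, ← hLa]; ring
      have h2 : |(b - ρ (N + m)) * y (N + m)| ≤ ε / 2 * (1 - b) := by
        rw [abs_mul]
        exact (mul_le_mul_of_nonneg_left (hB _) (abs_nonneg _)).trans (hN _ (by omega))
      have h3 : |-(b * (y (N + m) - L))| = b * |y (N + m) - L| := by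
        rw [abs_neg, abs_mul, abs_of_nonneg hb0]
      have h4 := mul_le_mul_of_nonneg_left ih hb0
      calc |y (N + (m + 1)) - L| ≤ b * |y (N + m) - L| + ε / 2 * (1 - b) := by
            rw [h1]; exact (abs_add_le _ _).trans (add_le_add h3.le h2)
        _ ≤ b ^ (m + 1) * |y N - L| + ε / 2 := by rw [pow_succ']; linarith
  have hpow : Tendsto (fun m : ℕ => b ^ m * |y N - L|) atTop (nhds 0) := by
    simpa using (tendsto_pow_atTop_nhds_zero_of_lt_one hb0 hb1).mul_const |y N - L|
  obtain ⟨M, hM⟩ := eventually_atTop.1 (hpow.eventually_lt_const (half_pos hε))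
  refine ⟨N + M, fun n hn => ?_⟩
  obtain ⟨m, rfl⟩ := Nat.exists_eq_add_of_le (show N ≤ n by omega)
  rw [Real.dist_eq]
  linarith [hstep m, hM m (by omega)]

/-- The product `∏_{1 ≤ k ≤ n} (2k + 1)²`. -/
noncomputable def oddSqProd (n : ℕ) : ℝ := ∏ k ∈ Finset.range n, (2 * (k : ℝ) + 3) ^ 2

lemma oddSqProd_succ (n : ℕ) : oddSqProd (n + 1) = oddSqProd n * (2 * (n : ℝ) + 3) ^ 2 :=
  Finset.prod_range_succ _ _

lemma oddSqProd_pos (n : ℕ) : 0 < oddSqProd n := Finset.prod_pos fun _ _ => by positivity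

section Convergents

variable {p q : ℕ → ℝ}

lemma convergent_rec {u : ℕ → ℝ}
    (hu : ∀ n : ℕ, 2 ≤ n →
      u n = (44 * (n : ℝ) ^ 2 + 1) * u (n - 1) + (2 * (n : ℝ) - 1) ^ 4 * u (n - 2)) (n : ℕ) :
    u (n + 2) = (44 * ((n : ℝ) + 2) ^ 2 + 1) * u (n + 1) + (2 * (n : ℝ) + 3) ^ 4 * u n := by
  have h := hu (n + 2) (by omega)
  rw [show n + 2 - 1 = n + 1 from rfl, show n + 2 - 2 = n from rfl] at h
  rw [h]
  push_cast
  ring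

lemma convergent_pos
    (hq : ∀ n : ℕ,
      q (n + 2) = (44 * ((n : ℝ) + 2) ^ 2 + 1) * q (n + 1) + (2 * (n : ℝ) + 3) ^ 4 * q n)
    (hq0 : q 0 = 1) (hq1 : q 1 = 47) (n : ℕ) : 0 < q n := by
  induction n using Nat.twoStepInduction with
  | zero => rw [hq0]; norm_num
  | one => rw [hq1]; norm_num
  | more n h0 h1 => rw [hq]; positivity

lemma casoratian_eq
    (hp : ∀ n : ℕ,
      p (n + 2) = (44 * ((n : ℝ) + 2) ^ 2 + 1) * p (n + 1) + (2 * (n : ℝ) + 3) ^ 4 * p n)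
    (hq : ∀ n : ℕ,
      q (n + 2) = (44 * ((n : ℝ) + 2) ^ 2 + 1) * q (n + 1) + (2 * (n : ℝ) + 3) ^ 4 * q n)
    (hp0 : p 0 = 80) (hp1 : p 1 = 3600) (hq0 : q 0 = 1) (hq1 : q 1 = 47) (n : ℕ) :
    p (n + 1) * q n - p n * q (n + 1) = (-1) ^ (n + 1) * 160 * oddSqProd n ^ 2 := by
  induction n with
  | zero => simp [hp0, hp1, hq0, hq1, oddSqProd]; norm_num
  | succ n ih =>
    rw [hp, hq, oddSqProd_succ, pow_succ]
    linear_combination (-(2 * (n : ℝ) + 3) ^ 4) * ih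

lemma mul_sub_eq_aperySum {s : ℝ} (hs : 0 < s) (h0 : aperySum 0 = π / 2 * s)
    (h1 : aperySum 1 = π * (80 - s ^ 2) / (4 * s))
    (hp : ∀ n : ℕ,
      p (n + 2) = (44 * ((n : ℝ) + 2) ^ 2 + 1) * p (n + 1) + (2 * (n : ℝ) + 3) ^ 4 * p n)
    (hq : ∀ n : ℕ,
      q (n + 2) = (44 * ((n : ℝ) + 2) ^ 2 + 1) * q (n + 1) + (2 * (n : ℝ) + 3) ^ 4 * q n)
    (hp0 : p 0 = 80) (hp1 : p 1 = 3600) (hq0 : q 0 = 1) (hq1 : q 1 = 47) (n : ℕ) :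
    s ^ 2 * q n - p n = (-1) ^ (n + 1) * (4 * s / π) * oddSqProd n * aperySum (n + 1) := by
  have hI1 : 4 * s / π * aperySum 1 = 80 - s ^ 2 := by rw [h1]; field_simp
  have hI0 : 4 * s / π * aperySum 0 = 2 * s ^ 2 := by rw [h0]; field_simp; ring
  induction n using Nat.twoStepInduction with
  | zero => simp [hp0, hq0, oddSqProd]; linear_combination hI1
  | one =>
    have h := aperySum_recurrence 0
    simp [hp1, hq1, oddSqProd] at h ⊢
    linear_combination (-(4 * s / π)) * h + 45 * hI1 - hI0
  | more n ih0 ih1 =>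
    have h := aperySum_recurrence (n + 1)
    rw [oddSqProd_succ] at ih1
    rw [hp, hq, oddSqProd_succ, oddSqProd_succ]
    push_cast at h ih1 ⊢
    linear_combination (44 * ((n : ℝ) + 2) ^ 2 + 1) * ih1 + (2 * (n : ℝ) + 3) ^ 4 * ih0
      - (-1) ^ (n + 3) * (4 * s / π) * oddSqProd n * (2 * (n : ℝ) + 3) ^ 2 * h

end Convergents

lemma tendsto_aperySum_mul_denominator {s : ℝ} (hs : 0 < s) {r : ℝ} (hr0 : 0 < r)
    (hr : r ^ 2 = 1 - r) {q : ℕ → ℝ} (hq : ∀ n, 0 < q n)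
    (hcas : ∀ n, aperySum (n + 2) * q n * (2 * (n : ℝ) + 3) ^ 2 + aperySum (n + 1) * q (n + 1) =
      160 / s * oddSqProd n) :
    Tendsto (fun n : ℕ => (2 * (n : ℝ) + 1) ^ 2 * s * (q n / oddSqProd n) * aperySum n) atTop
      (nhds (160 / (1 + r ^ 10))) := by
  have hr1 : r < 1 := by nlinarith
  obtain ⟨c, hc0, -, hc⟩ := exists_tendsto_mul_aperySum hr0 hr
  set y : ℕ → ℝ := fun n => (2 * (n : ℝ) + 1) ^ 2 * s * (q n / oddSqProd n) * aperySum n with hy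
  set ρ : ℕ → ℝ := fun n => (2 * (n : ℝ) + 3) ^ 2 * aperySum (n + 2) /
    ((2 * (n : ℝ) + 1) ^ 2 * aperySum n) with hρ
  have hpos (n : ℕ) : 0 < y n := by
    have := hq n
    have := oddSqProd_pos n
    have := aperySum_pos n
    positivity
  have hρpos (n : ℕ) : 0 < ρ n := by
    have := aperySum_pos n
    have := aperySum_pos (n + 2)
    positivity
  have hrec (n : ℕ) : y (n + 1) = 160 - ρ n * y n := by
    have h1 := oddSqProd_pos n
    have h2 := (aperySum_pos n).ne'
    have h := hcas n
    simp only [hy, hρ]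
    rw [oddSqProd_succ]
    push_cast
    rw [show 2 * ((n : ℝ) + 1) + 1 = 2 * n + 3 by ring]
    field_simp at h ⊢
    linear_combination h
  have hbound (n : ℕ) : |y n| ≤ max (y 0) 160 := by
    rw [abs_of_pos (hpos n)]
    cases n with
    | zero => exact le_max_left _ _
    | succ n =>
      rw [hrec]
      exact le_max_of_le_right (by linarith [mul_pos (hρpos n) (hpos n)])
  refine tendsto_of_affine_recurrence (by positivity) (pow_lt_one₀ hr0.le hr1 (by norm_num))
    hbound hrec ?_
  have hinv : Tendsto (fun n : ℕ => ((n : ℝ))⁻¹) atTop (nhds 0) := tendsto_inv_atTop_nhds_zero_nat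
  have h1 : Tendsto (fun n : ℕ => ((2 + 3 * (n : ℝ)⁻¹) ^ 2) / ((2 + (n : ℝ)⁻¹) ^ 2 *
      (1 + 2 * (n : ℝ)⁻¹))) atTop (nhds 1) := by
    have h : ContinuousAt (fun e : ℝ => (2 + 3 * e) ^ 2 / ((2 + e) ^ 2 * (1 + 2 * e))) 0 := by
      refine ContinuousAt.div (by fun_prop) (by fun_prop) (by norm_num)
    simpa [Function.comp_def] using h.tendsto.comp hinv
  have h2 := ((((tendsto_add_atTop_iff_nat 2).2 hc).div hc hc0.ne').mul h1).mul_const (r ^ 10)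
  rw [div_self hc0.ne', one_mul, one_mul] at h2
  refine h2.congr' ?_
  filter_upwards [eventually_gt_atTop 0] with n hn
  have hn' : (0 : ℝ) < n := by exact_mod_cast hn
  have := (aperySum_pos n).ne'
  simp only [hρ, Pi.div_apply]
  push_cast
  rw [pow_add]
  field_simp

/-- The continued fraction `[[80,47,44n²+1],[-160,(2n+1)⁴]]` converges to
`(Γ(1/4)/Γ(3/4))⁴`, with speed `(-1)^(n+1)·8(Γ(1/4)/Γ(3/4))⁴/((1+√5)/2)^(10n+10)`. -/
theorem shifted_small_apery (p q : ℕ → ℝ)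
    (hp : ∀ n : ℕ, 2 ≤ n →
      p n = (44 * (n : ℝ) ^ 2 + 1) * p (n - 1) + (2 * (n : ℝ) - 1) ^ 4 * p (n - 2))
    (hq : ∀ n : ℕ, 2 ≤ n →
      q n = (44 * (n : ℝ) ^ 2 + 1) * q (n - 1) + (2 * (n : ℝ) - 1) ^ 4 * q (n - 2))
    (hp0 : p 0 = 80) (hp1 : p 1 = 3600) (hq0 : q 0 = 1) (hq1 : q 1 = 47) :
    (∀ n, q n ≠ 0) ∧
    Tendsto (fun n => p n / q n) atTop
      (nhds ((Real.Gamma (1 / 4) / Real.Gamma (3 / 4)) ^ 4)) ∧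
    (fun n : ℕ => (Real.Gamma (1 / 4) / Real.Gamma (3 / 4)) ^ 4 - p n / q n) ~[atTop]
      (fun n : ℕ => (-1 : ℝ) ^ (n + 1) * (8 * (Real.Gamma (1 / 4) / Real.Gamma (3 / 4)) ^ 4)
        / ((1 + Real.sqrt 5) / 2) ^ (10 * n + 10)) := by
  have hp' := convergent_rec hp
  have hq' := convergent_rec hq
  have hqpos := convergent_pos hq' hq0 hq1
  have hG1 : 0 < Real.Gamma (1 / 4) := Real.Gamma_pos_of_pos (by norm_num)
  have hG3 : 0 < Real.Gamma (3 / 4) := Real.Gamma_pos_of_pos (by norm_num)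
  obtain ⟨s, hs_def⟩ : ∃ s, s = Real.Gamma (1 / 4) ^ 2 / Real.Gamma (3 / 4) ^ 2 := ⟨_, rfl⟩
  have hs : 0 < s := by rw [hs_def]; positivity
  have hS : (Real.Gamma (1 / 4) / Real.Gamma (3 / 4)) ^ 4 = s ^ 2 := by
    rw [hs_def, div_pow, div_pow]; ring
  have hI0 : aperySum 0 = π / 2 * s := by rw [hs_def]; exact aperySum_zero_eq
  have hI1 : aperySum 1 = π * (80 - s ^ 2) / (4 * s) := by rw [hs_def]; exact aperySum_one_eq
  have herr := mul_sub_eq_aperySum hs hI0 hI1 hp' hq' hp0 hp1 hq0 hq1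
  have hcas (n : ℕ) : aperySum (n + 2) * q n * (2 * (n : ℝ) + 3) ^ 2 +
      aperySum (n + 1) * q (n + 1) = 160 / (4 * s / π) * oddSqProd n := by
    have h := casoratian_eq hp' hq' hp0 hp1 hq0 hq1 n
    have he0 := herr n
    have he1 := herr (n + 1)
    rw [oddSqProd_succ] at he1
    have hD := (oddSqProd_pos n).ne'
    have hsign : ((-1 : ℝ) ^ n) ^ 2 = 1 := by rw [← pow_mul, mul_comm, pow_mul]; norm_num
    have hmul : (4 * s / π) * (aperySum (n + 2) * q n * (2 * (n : ℝ) + 3) ^ 2 +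
        aperySum (n + 1) * q (n + 1)) = 160 * oddSqProd n := by
      apply mul_left_cancel₀ hD
      apply mul_left_cancel₀ (pow_ne_zero n (show (-1 : ℝ) ≠ 0 by norm_num))
      rw [pow_succ] at h he0 he1
      rw [pow_succ] at he1
      linear_combination -he1 * q n + he0 * q (n + 1) - h
    rw [div_mul_eq_mul_div, eq_div_iff (by positivity), ← hmul]
    ring
  obtain ⟨r, hr_def⟩ : ∃ r, r = ((1 + √5) / 2)⁻¹ := ⟨_, rfl⟩
  have hr0 : 0 < r := by rw [hr_def]; positivity
  have hr : r ^ 2 = 1 - r := by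
    have h5 : √5 ^ 2 = 5 := Real.sq_sqrt (by norm_num)
    rw [hr_def]
    field_simp
    linear_combination -h5
  obtain ⟨c, hc0, hc2, hc⟩ := exists_tendsto_mul_aperySum hr0 hr
  have hy := tendsto_aperySum_mul_denominator (s := 4 * s / π) (by positivity) hr0 hr hqpos hcas
  have hequiv : (fun n : ℕ => s ^ 2 - p n / q n) ~[atTop]
      fun n : ℕ => (-1 : ℝ) ^ (n + 1) * (8 * s ^ 2) / ((1 + √5) / 2) ^ (10 * n + 10) := by
    have hne (n : ℕ) : (-1 : ℝ) ^ (n + 1) * (8 * s ^ 2) / ((1 + √5) / 2) ^ (10 * n + 10) ≠ 0 := by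
      have : (-1 : ℝ) ^ (n + 1) ≠ 0 := pow_ne_zero _ (by norm_num)
      positivity
    rw [isEquivalent_iff_tendsto_one (Eventually.of_forall hne)]
    have hinv : Tendsto (fun n : ℕ => ((n : ℝ))⁻¹) atTop (nhds 0) := tendsto_inv_atTop_nhds_zero_nat
    have h1 : Tendsto (fun n : ℕ => (2 + (n : ℝ)⁻¹) ^ 2 / (1 + (n : ℝ)⁻¹)) atTop (nhds 4) := by
      have h : ContinuousAt (fun e : ℝ => (2 + e) ^ 2 / (1 + e)) 0 :=
        ContinuousAt.div (by fun_prop) (by fun_prop) (by norm_num)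
      have h' := h.tendsto.comp hinv
      norm_num [Function.comp_def] at h'
      exact h'
    have h2 := ((((((tendsto_add_atTop_iff_nat 1).2 hc).mul hc).mul h1).mul_const
      ((4 * s / π) ^ 2 / (8 * s ^ 2 * r ^ 5))).div hy (by positivity))
    have hval : c * c * 4 * ((4 * s / π) ^ 2 / (8 * s ^ 2 * r ^ 5)) / (160 / (1 + r ^ 10)) = 1 := by
      have h5 : r ^ 5 = 5 * r - 3 := by linear_combination (r ^ 3 - r ^ 2 + 2 * r - 3) * hr
      have h10 : r ^ 10 = 34 - 55 * r := by
        linear_combination (r ^ 5 + 5 * r - 3) * h5 + 25 * hr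
      rw [← sq, hc2, h10, h5]
      have h53 : r * 5 - 3 ≠ 0 := by rw [mul_comm, ← h5]; positivity
      field_simp
      linear_combination -12800 * hr
    rw [hval] at h2
    refine h2.congr' ?_
    filter_upwards [eventually_gt_atTop 0] with n hn
    have hn' : (0 : ℝ) < n := by exact_mod_cast hn
    have hq0' := (hqpos n).ne'
    have hD := (oddSqProd_pos n).ne'
    have hI := (aperySum_pos n).ne'
    have hsn : (-1 : ℝ) ^ (n + 1) ≠ 0 := pow_ne_zero _ (by norm_num)
    have he : s ^ 2 - p n / q n =
        (-1) ^ (n + 1) * (4 * s / π) * oddSqProd n * aperySum (n + 1) / q n := by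
      rw [← herr]; field_simp
    have hrn : ((1 + √5) / 2) ^ (10 * n + 10) = (r ^ (10 * n + 10))⁻¹ := by
      rw [hr_def, inv_pow, inv_inv]
    have hr10 : r ^ (10 * n + 10) = (r ^ 5) ^ n * ((r ^ 5) ^ n * (r ^ 5 * r ^ 5)) := by ring
    simp only [Pi.div_apply]
    rw [he, hrn, hr10, pow_succ (r ^ 5)]
    push_cast
    field_simp
  refine ⟨fun n => (hqpos n).ne', ?_, ?_⟩
  · rw [hS]
    have hz : Tendsto (fun n : ℕ => (-1 : ℝ) ^ (n + 1) * (8 * s ^ 2) /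
        ((1 + √5) / 2) ^ (10 * n + 10)) atTop (nhds 0) := by
      have hr1 : r < 1 := by nlinarith
      have hlt : |-r ^ 10| < 1 := by
        rw [abs_neg, abs_of_pos (by positivity)]
        exact pow_lt_one₀ hr0.le hr1 (by norm_num)
      have h := (tendsto_pow_atTop_nhds_zero_of_abs_lt_one hlt).mul_const (-(8 * s ^ 2 * r ^ 10))
      rw [zero_mul] at h
      refine h.congr fun n => ?_
      rw [div_eq_mul_inv, ← inv_pow, ← hr_def, neg_pow, pow_succ]
      ring
    have h := (hequiv.symm.tendsto_nhds hz).const_sub (s ^ 2)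
    rw [sub_zero] at h
    exact h.congr fun n => by ring
  · rw [hS]
    exact hequiv
end

section
/- Let p, q : ℕ → ℝ both satisfy the recurrence u(n) = 16n·u(n-1) + (2n-1)⁴·u(n-2) for all n ≥ 2, with initial values p(0) = 80, p(1) = 80·17 - 64 = 1296, q(0) = 1, q(1) = 17. Then q(n) ≠ 0 for all n and the sequence p(n)/q(n) converges to (Γ(1/4)/Γ(3/4))⁴. -/
open Filter Real

/-- A sequence converges as soon as its even and odd subsequences converge to the same limit. -/
theorem tendsto_atTop_of_even_odd {α : Type*} {f : ℕ → α} {l : Filter α}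
    (he : Tendsto (fun n => f (2 * n)) atTop l)
    (ho : Tendsto (fun n => f (2 * n + 1)) atTop l) : Tendsto f atTop l := by
  intro s hs
  obtain ⟨a, ha⟩ := mem_atTop_sets.1 (he hs)
  obtain ⟨b, hb⟩ := mem_atTop_sets.1 (ho hs)
  refine mem_atTop_sets.2 ⟨2 * (a + b) + 1, fun n hn => ?_⟩
  obtain ⟨m, rfl | rfl⟩ := n.even_or_odd'
  · exact ha m (by omega)
  · exact hb m (by omega)

/-- The finite products in Euler's limit formula compute a power of the quotient of
Gamma values at `1/4` and `3/4`. -/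
theorem tendsto_prod_ratio_div_sq :
    Tendsto (fun k : ℕ => ((∏ j ∈ Finset.range (k + 1), ((3 / 4 : ℝ) + j)) /
        ∏ j ∈ Finset.range (k + 1), ((1 / 4 : ℝ) + j)) ^ 4 / (k : ℝ) ^ 2) atTop
      (nhds ((Real.Gamma (1 / 4) / Real.Gamma (3 / 4)) ^ 4)) := by
  have h := ((Real.GammaSeq_tendsto_Gamma (1 / 4)).div (Real.GammaSeq_tendsto_Gamma (3 / 4))
    (Real.Gamma_pos_of_pos (by norm_num)).ne').pow 4
  refine h.congr' ?_
  filter_upwards [eventually_gt_atTop 0] with k hk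
  have hk' : (0 : ℝ) < k := by exact_mod_cast hk
  have h1 : ((k : ℝ) ^ (1 / 4 : ℝ)) ^ 4 = k := by
    rw [← Real.rpow_natCast, ← Real.rpow_mul hk'.le]; norm_num
  have h3 : ((k : ℝ) ^ (3 / 4 : ℝ)) ^ 4 = (k : ℝ) ^ 3 := by
    rw [← Real.rpow_natCast, ← Real.rpow_mul hk'.le, ← Real.rpow_natCast]; norm_num
  have hf : (k.factorial : ℝ) ≠ 0 := by positivity
  have hP : (∏ j ∈ Finset.range (k + 1), ((3 / 4 : ℝ) + j)) ≠ 0 :=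
    Finset.prod_ne_zero_iff.2 fun j _ => by positivity
  have hQ : (∏ j ∈ Finset.range (k + 1), ((1 / 4 : ℝ) + j)) ≠ 0 :=
    Finset.prod_ne_zero_iff.2 fun j _ => by positivity
  simp only [Pi.div_apply, Real.GammaSeq, div_pow, mul_pow, h1, h3]
  field_simp

/-- Closed form of the denominators of the continued fraction. -/
theorem denominator_closed_form {q : ℕ → ℝ}
    (hq : ∀ n : ℕ, 2 ≤ n →
      q n = 16 * (n : ℝ) * q (n - 1) + (2 * (n : ℝ) - 1) ^ 4 * q (n - 2))
    (hq0 : q 0 = 1) (hq1 : q 1 = 17) (k : ℕ) :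
    q (2 * k) = 256 ^ (k + 1) * (∏ j ∈ Finset.range (k + 1), ((1 / 4 : ℝ) + j)) ^ 4 ∧
    q (2 * k + 1) = 256 ^ (k + 1) * (∏ j ∈ Finset.range (k + 1), ((1 / 4 : ℝ) + j)) ^ 4 *
      (16 * ((k : ℝ) + 1) ^ 2 + 1) := by
  induction k with
  | zero => norm_num [hq0, hq1]
  | succ k ih =>
    obtain ⟨h0, h1⟩ := ih
    have e0 := hq (2 * k + 2) (by omega)
    have e1 := hq (2 * k + 3) (by omega)
    simp only [show 2 * k + 2 - 1 = 2 * k + 1 by omega, show 2 * k + 2 - 2 = 2 * k by omega,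
      show 2 * k + 3 - 1 = 2 * k + 2 by omega, show 2 * k + 3 - 2 = 2 * k + 1 by omega] at e0 e1
    rw [Finset.prod_range_succ _ (k + 1), show 2 * (k + 1) + 1 = 2 * k + 3 by ring,
      show 2 * (k + 1) = 2 * k + 2 by ring, e1, e0, h0, h1]
    push_cast
    constructor <;> ring

/-- Closed form of the numerators of the continued fraction. -/
theorem numerator_closed_form {p : ℕ → ℝ}
    (hp : ∀ n : ℕ, 2 ≤ n →
      p n = 16 * (n : ℝ) * p (n - 1) + (2 * (n : ℝ) - 1) ^ 4 * p (n - 2))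
    (hp0 : p 0 = 80) (hp1 : p 1 = 1296) (k : ℕ) :
    p (2 * k) * (4 * (k : ℝ) + 3) ^ 4 =
      16 * 256 ^ (k + 1) * (∏ j ∈ Finset.range (k + 1), ((3 / 4 : ℝ) + j)) ^ 4 *
        ((4 * (k : ℝ) + 2) ^ 2 + 1) ∧
    p (2 * k + 1) =
      16 * 256 ^ (k + 1) * (∏ j ∈ Finset.range (k + 1), ((3 / 4 : ℝ) + j)) ^ 4 := by
  induction k with
  | zero => norm_num [hp0, hp1]
  | succ k ih =>
    obtain ⟨h0, h1⟩ := ih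
    have e0 := hp (2 * k + 2) (by omega)
    have e1 := hp (2 * k + 3) (by omega)
    simp only [show 2 * k + 2 - 1 = 2 * k + 1 by omega, show 2 * k + 2 - 2 = 2 * k by omega,
      show 2 * k + 3 - 1 = 2 * k + 2 by omega, show 2 * k + 3 - 2 = 2 * k + 1 by omega] at e0 e1
    push_cast at e0 e1
    have h2 : p (2 * k + 2) = 16 * 256 ^ (k + 1) *
        (∏ j ∈ Finset.range (k + 1), ((3 / 4 : ℝ) + j)) ^ 4 * ((4 * (k : ℝ) + 6) ^ 2 + 1) := by
      linear_combination e0 + h0 + 16 * (2 * (k : ℝ) + 2) * h1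
    rw [Finset.prod_range_succ _ (k + 1), show 2 * (k + 1) + 1 = 2 * k + 3 by ring,
      show 2 * (k + 1) = 2 * k + 2 by ring, e1, h2, h1]
    push_cast
    constructor <;> ring

/-- The Ramanujan-type continued fraction `[[80,17,16n],[-64,(2n+1)⁴]]` converges to
`(Γ(1/4)/Γ(3/4))⁴`. -/
theorem ramanujan_cf_gamma_quotient (p q : ℕ → ℝ)
    (hp : ∀ n : ℕ, 2 ≤ n →
      p n = 16 * (n : ℝ) * p (n - 1) + (2 * (n : ℝ) - 1) ^ 4 * p (n - 2))
    (hq : ∀ n : ℕ, 2 ≤ n →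
      q n = 16 * (n : ℝ) * q (n - 1) + (2 * (n : ℝ) - 1) ^ 4 * q (n - 2))
    (hp0 : p 0 = 80) (hp1 : p 1 = 1296) (hq0 : q 0 = 1) (hq1 : q 1 = 17) :
    (∀ n, q n ≠ 0) ∧
    Tendsto (fun n => p n / q n) atTop
      (nhds ((Real.Gamma (1 / 4) / Real.Gamma (3 / 4)) ^ 4)) := by
  have hq' := denominator_closed_form hq hq0 hq1
  have hp' := numerator_closed_form hp hp0 hp1
  have hQ (k : ℕ) : (∏ j ∈ Finset.range (k + 1), ((1 / 4 : ℝ) + j)) ≠ 0 :=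
    Finset.prod_ne_zero_iff.2 fun j _ => by positivity
  have hinv : Tendsto (fun k : ℕ => (k : ℝ)⁻¹) atTop (nhds 0) :=
    tendsto_inv_atTop_nhds_zero_nat
  refine ⟨fun n => ?_, tendsto_atTop_of_even_odd ?_ ?_⟩
  · obtain ⟨k, rfl | rfl⟩ := n.even_or_odd'
    · rw [(hq' k).1]
      have := hQ k
      positivity
    · rw [(hq' k).2]
      have := hQ k
      positivity
  · have hc : Tendsto (fun k : ℕ => 16 * ((4 + 2 * (k : ℝ)⁻¹) ^ 2 + (k : ℝ)⁻¹ ^ 2) /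
        (4 + 3 * (k : ℝ)⁻¹) ^ 4) atTop (nhds 1) := by
      have : ContinuousAt (fun x : ℝ => 16 * ((4 + 2 * x) ^ 2 + x ^ 2) / (4 + 3 * x) ^ 4) 0 :=
        ContinuousAt.div (by fun_prop) (by fun_prop) (by norm_num)
      convert this.tendsto.comp hinv using 2 <;> norm_num
    have h := tendsto_prod_ratio_div_sq.mul hc
    rw [mul_one] at h
    refine h.congr' ?_
    filter_upwards [eventually_gt_atTop 0] with k hk
    have hk' : (0 : ℝ) < k := by exact_mod_cast hk
    have := hQ k
    rw [(hq' k).1, eq_div_of_mul_eq (by positivity) (hp' k).1]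
    field_simp
  · have hc : Tendsto (fun k : ℕ => 16 / (16 * (1 + (k : ℝ)⁻¹) ^ 2 + (k : ℝ)⁻¹ ^ 2))
        atTop (nhds 1) := by
      have : ContinuousAt (fun x : ℝ => 16 / (16 * (1 + x) ^ 2 + x ^ 2)) 0 :=
        ContinuousAt.div (by fun_prop) (by fun_prop) (by norm_num)
      convert this.tendsto.comp hinv using 2 <;> norm_num
    have h := tendsto_prod_ratio_div_sq.mul hc
    rw [mul_one] at h
    refine h.congr' ?_
    filter_upwards [eventually_gt_atTop 0] with k hk
    have hk' : (0 : ℝ) < k := by exact_mod_cast hk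
    have := hQ k
    rw [(hq' k).2, (hp' k).2]
    field_simp
end

section
/- The following series identity holds: (Γ(1/4)/Γ(3/4))⁴ = 80 - (2048/625)·Σ_{n≥0} (n+1)·((3/4)_n)⁴/((9/4)_n)⁴, where the series converges. -/
open Finset

/-- The rising Pochhammer symbol `(a)_n = a(a+1)⋯(a+n-1)`. -/
def poch (a : ℝ) (n : ℕ) : ℝ := ∏ i ∈ Finset.range n, (a + i)

/-- Ratios of Pochhammer symbols are, up to a power of `n`, ratios of Euler's sequences for `Γ`. -/
theorem poch_ratio_pow_four_eq (n : ℕ) (hn : n ≠ 0) :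
    (n : ℝ) ^ 6 * (poch (3 / 4) (n + 1) / poch (9 / 4) (n + 1)) ^ 4 =
      (Real.GammaSeq (9 / 4) n / Real.GammaSeq (3 / 4) n) ^ 4 := by
  have hn' : (0 : ℝ) < n := by positivity
  have hp : 0 < poch (3 / 4) (n + 1) := Finset.prod_pos fun i _ => by positivity
  have hq : 0 < poch (9 / 4) (n + 1) := Finset.prod_pos fun i _ => by positivity
  have hpow : ((n : ℝ) ^ (9 / 4 : ℝ)) ^ 4 = n ^ 6 * ((n : ℝ) ^ (3 / 4 : ℝ)) ^ 4 := by
    simp only [← Real.rpow_natCast, ← Real.rpow_mul hn'.le, ← Real.rpow_add hn']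
    norm_num
  have hx : (0 : ℝ) < (n : ℝ) ^ (3 / 4 : ℝ) := Real.rpow_pos_of_pos hn' _
  have hf : (0 : ℝ) < (n.factorial : ℝ) := by positivity
  unfold Real.GammaSeq
  change _ = ((n : ℝ) ^ (9 / 4 : ℝ) * n.factorial / poch (9 / 4) (n + 1) /
    ((n : ℝ) ^ (3 / 4 : ℝ) * n.factorial / poch (3 / 4) (n + 1))) ^ 4
  simp only [div_pow, mul_pow, hpow]
  field_simp

theorem poch_succ (a : ℝ) (n : ℕ) : poch a (n + 1) = poch a n * (a + n) :=
  Finset.prod_range_succ _ _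

/-- The summand has a hypergeometric antidifference, so its partial sums are explicit. -/
theorem sum_range_poch_ratio (n : ℕ) :
    ∑ k ∈ range n, ((k : ℝ) + 1) * poch (3 / 4) k ^ 4 / poch (9 / 4) k ^ 4 =
      3125 / 128 - 4 * (n + 5 / 4 : ℝ) ^ 4 * (8 * (n + 3 / 4) * (n + 1 / 4) + 1) *
        (poch (3 / 4) n / poch (9 / 4) n) ^ 4 := by
  induction n with
  | zero => norm_num [poch]
  | succ n ih =>
    have hq : poch (9 / 4) n ≠ 0 := (Finset.prod_pos fun i _ => by positivity).ne'
    have hn : (9 / 4 + n : ℝ) ≠ 0 := by positivity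
    rw [Finset.sum_range_succ, ih, poch_succ, poch_succ]
    push_cast
    generalize poch (3 / 4) n = p at *
    generalize poch (9 / 4) n = q at *
    have e : (p * (3 / 4 + n) / (q * (9 / 4 + n))) ^ 4
        = (p / q) ^ 4 * ((3 / 4 + n : ℝ) ^ 4 / (9 / 4 + n : ℝ) ^ 4) := by
      field_simp
    have e' : ((n : ℝ) + 1) * p ^ 4 / q ^ 4 = (p / q) ^ 4 * (n + 1) := by
      field_simp
    have e'' : ((n : ℝ) + 1 + 5 / 4) ^ 4 * ((3 / 4 + n : ℝ) ^ 4 / (9 / 4 + n : ℝ) ^ 4)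
        = (3 / 4 + n : ℝ) ^ 4 := by
      field_simp
      ring
    rw [e, e']
    linear_combination
      (4 * (8 * ((n : ℝ) + 1 + 3 / 4) * (n + 1 + 1 / 4) + 1) * (p / q) ^ 4) * e''

open Filter Topology in
theorem tendsto_sum_range_poch_ratio :
    Tendsto (fun n : ℕ =>
        ∑ k ∈ range n, ((k : ℝ) + 1) * poch (3 / 4) k ^ 4 / poch (9 / 4) k ^ 4) atTop
      (𝓝 (3125 / 128 - 32 * (Real.Gamma (9 / 4) / Real.Gamma (3 / 4)) ^ 4)) := by
  rw [← tendsto_add_atTop_iff_nat 1]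
  have hΓ : Tendsto (fun n : ℕ => (Real.GammaSeq (9 / 4) n / Real.GammaSeq (3 / 4) n) ^ 4)
      atTop (𝓝 ((Real.Gamma (9 / 4) / Real.Gamma (3 / 4)) ^ 4)) :=
    ((Real.GammaSeq_tendsto_Gamma _).div (Real.GammaSeq_tendsto_Gamma _)
      (Real.Gamma_pos_of_pos (by norm_num)).ne').pow 4
  have hinv : Tendsto (fun n : ℕ => ((n : ℝ))⁻¹) atTop (𝓝 0) := tendsto_inv_atTop_nhds_zero_nat
  have hcont : Continuous fun x : ℝ =>
      4 * (1 + 9 / 4 * x) ^ 4 * (8 * (1 + 7 / 4 * x) * (1 + 5 / 4 * x) + x ^ 2) := by fun_prop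
  have hpoly := (hcont.tendsto 0).comp hinv
  have h := (hpoly.mul hΓ).const_sub (3125 / 128)
  norm_num only [mul_zero, add_zero] at h
  refine h.congr' ?_
  filter_upwards [eventually_ne_atTop 0] with n hn
  have hn' : (n : ℝ) ≠ 0 := by exact_mod_cast hn
  rw [sum_range_poch_ratio, ← poch_ratio_pow_four_eq n hn]
  generalize (poch (3 / 4) (n + 1) / poch (9 / 4) (n + 1)) ^ 4 = r
  simp only [Function.comp_apply]
  push_cast
  field_simp
  ring

theorem Gamma_nine_fourths : Real.Gamma (9 / 4) = 5 / 16 * Real.Gamma (1 / 4) := by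
  rw [show (9 / 4 : ℝ) = 1 / 4 + 1 + 1 by norm_num, Real.Gamma_add_one (by norm_num),
    Real.Gamma_add_one (by norm_num)]
  ring

/-- The hypergeometric identity
`(Γ(1/4)/Γ(3/4))⁴ = 80 - (2048/625)·Σ_{n≥0} (n+1)((3/4)_n)⁴/((9/4)_n)⁴`. -/
theorem gamma_quotient_series :
    Summable (fun n : ℕ => ((n : ℝ) + 1) * poch (3 / 4) n ^ 4 / poch (9 / 4) n ^ 4) ∧
    (Real.Gamma (1 / 4) / Real.Gamma (3 / 4)) ^ 4
      = 80 - (2048 / 625) *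
          ∑' n : ℕ, ((n : ℝ) + 1) * poch (3 / 4) n ^ 4 / poch (9 / 4) n ^ 4 := by
  have h := (hasSum_iff_tendsto_nat_of_nonneg (fun n => by positivity) _).2
    tendsto_sum_range_poch_ratio
  refine ⟨h.summable, ?_⟩
  rw [h.tsum_eq, Gamma_nine_fourths]
  ring
end

section
/- The double integral ∬_{[0,1]²} √(x(1-x)y(1-y))/(1-xy)^{3/2} dx dy converges, and its negative equals (π/4)·Γ(1/4)²/Γ(3/4)² - 20π·Γ(3/4)²/Γ(1/4)². (Equivalently, I₂(1) = (π/4)·Γ(1/4)²/Γ(3/4)² - 20π·Γ(3/4)²/Γ(1/4)², where I₂(1) = -∬_{[0,1]²} x^{1/2}(1-x)^{1/2}y^{1/2}(1-y)^{1/2}(1-xy)^{-3/2} dx dy.) -/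
open MeasureTheory Real

lemma beta_integrableOn_and_integral {u v : ℝ} (hu : 0 < u) (hv : 0 < v) :
    IntegrableOn (fun x : ℝ => x ^ (u - 1) * (1 - x) ^ (v - 1)) (Set.Ioo 0 1) ∧
    ∫ x in Set.Ioo (0 : ℝ) 1, x ^ (u - 1) * (1 - x) ^ (v - 1) = ProbabilityTheory.beta u v := by
  have hB := ProbabilityTheory.beta_pos hu hv
  have h1 := ProbabilityTheory.lintegral_betaPDF (α := u) (β := v)
  rw [ProbabilityTheory.lintegral_betaPDF_eq_one hu hv] at h1
  have hnn : 0 ≤ᵐ[volume.restrict (Set.Ioo (0 : ℝ) 1)] fun x : ℝ =>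
      1 / ProbabilityTheory.beta u v * x ^ (u - 1) * (1 - x) ^ (v - 1) := by
    filter_upwards [ae_restrict_mem measurableSet_Ioo] with x hx
    have := hx.1
    have : 0 < 1 - x := sub_pos.2 hx.2
    simp only [Pi.zero_apply]
    positivity
  have hm : AEStronglyMeasurable (fun x : ℝ =>
      1 / ProbabilityTheory.beta u v * x ^ (u - 1) * (1 - x) ^ (v - 1))
      (volume.restrict (Set.Ioo (0 : ℝ) 1)) := by
    apply Measurable.aestronglyMeasurable
    fun_prop
  have hi : IntegrableOn (fun x : ℝ =>
      1 / ProbabilityTheory.beta u v * x ^ (u - 1) * (1 - x) ^ (v - 1)) (Set.Ioo 0 1) := by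
    refine ⟨hm, ?_⟩
    rw [hasFiniteIntegral_iff_ofReal hnn, ← h1]
    exact ENNReal.one_lt_top
  have hint := integral_eq_lintegral_of_nonneg_ae hnn hm
  rw [← h1] at hint
  have e : (fun x : ℝ => x ^ (u - 1) * (1 - x) ^ (v - 1)) = fun x : ℝ =>
      ProbabilityTheory.beta u v *
        (1 / ProbabilityTheory.beta u v * x ^ (u - 1) * (1 - x) ^ (v - 1)) := by
    ext x; field_simp
  rw [e]
  refine ⟨hi.const_mul _, ?_⟩
  rw [integral_const_mul, hint]
  simp

lemma sin_pos_and_cos_pos {a : ℝ} (ha : a ∈ Set.Ioo 0 (π / 2)) : 0 < sin a ∧ 0 < cos a :=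
  ⟨sin_pos_of_pos_of_lt_pi ha.1 (by linarith [ha.2, pi_pos]),
    cos_pos_of_mem_Ioo ⟨by linarith [ha.1, pi_pos], ha.2⟩⟩

lemma injOn_sin_sq : Set.InjOn (fun a : ℝ => sin a ^ 2) (Set.Ioo 0 (π / 2)) := by
  intro a ha b hb hab
  exact injOn_sin ⟨by linarith [ha.1, pi_pos], ha.2.le⟩ ⟨by linarith [hb.1, pi_pos], hb.2.le⟩
    ((pow_left_inj₀ (sin_pos_and_cos_pos ha).1.le (sin_pos_and_cos_pos hb).1.le
      two_ne_zero).1 hab)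

lemma image_sin_sq_Ioo : (fun a : ℝ => sin a ^ 2) '' Set.Ioo 0 (π / 2) = Set.Ioo 0 1 := by
  ext x
  constructor
  · rintro ⟨a, ha, rfl⟩
    obtain ⟨hs, hc⟩ := sin_pos_and_cos_pos ha
    refine ⟨by positivity, ?_⟩
    show sin a ^ 2 < 1
    nlinarith [sin_sq_add_cos_sq a]
  · rintro ⟨h0, h1⟩
    refine ⟨arcsin (√x), ⟨arcsin_pos.2 (sqrt_pos.2 h0), arcsin_lt_pi_div_two.2 ?_⟩, ?_⟩
    · rw [sqrt_lt' one_pos]; simpa using h1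
    · have : √x ≤ 1 := sqrt_le_iff.2 ⟨zero_le_one, by linarith⟩
      show sin (arcsin √x) ^ 2 = x
      rw [sin_arcsin (by linarith [sqrt_nonneg x]) this, sq_sqrt h0.le]

lemma sin_rpow_integrableOn_and_integral {u : ℝ} (hu : 0 < u) :
    IntegrableOn (fun a : ℝ => sin a ^ (2 * u - 1)) (Set.Ioo 0 (π / 2)) ∧
    ∫ a in Set.Ioo (0 : ℝ) (π / 2), sin a ^ (2 * u - 1) =
      ProbabilityTheory.beta u (1 / 2) / 2 := by
  obtain ⟨hi, hv⟩ := beta_integrableOn_and_integral hu (v := 1 / 2) (by norm_num)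
  have hd : ∀ a ∈ Set.Ioo (0 : ℝ) (π / 2), HasDerivWithinAt (fun a : ℝ => sin a ^ 2)
      (2 * sin a * cos a) (Set.Ioo 0 (π / 2)) a := fun a _ => by
    simpa using! ((hasDerivAt_sin a).pow 2).hasDerivWithinAt
  have key : Set.EqOn (fun a : ℝ => |2 * sin a * cos a| •
      ((sin a ^ 2) ^ (u - 1) * (1 - sin a ^ 2) ^ ((1 : ℝ) / 2 - 1)))
      (fun a => 2 * sin a ^ (2 * u - 1)) (Set.Ioo 0 (π / 2)) := by
    intro a ha
    obtain ⟨hs, hc⟩ := sin_pos_and_cos_pos ha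
    have e1 : (sin a ^ 2) ^ (u - 1) * sin a = sin a ^ (2 * u - 1) := by
      rw [← rpow_natCast, ← rpow_mul hs.le, ← rpow_add_one hs.ne']
      congr 1; push_cast; ring
    have e2 : (1 - sin a ^ 2) ^ ((1 : ℝ) / 2 - 1) * cos a = 1 := by
      rw [← cos_sq', ← rpow_natCast, ← rpow_mul hc.le, ← rpow_add_one hc.ne']
      norm_num
    simp only [smul_eq_mul]
    rw [abs_of_pos (by positivity), ← e1]
    linear_combination 2 * (sin a ^ 2) ^ (u - 1) * sin a * e2
  rw [← image_sin_sq_Ioo] at hi hv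
  rw [integrableOn_image_iff_integrableOn_abs_deriv_smul measurableSet_Ioo hd injOn_sin_sq,
    integrableOn_congr_fun key measurableSet_Ioo] at hi
  rw [integral_image_eq_integral_abs_deriv_smul measurableSet_Ioo hd injOn_sin_sq,
    setIntegral_congr_fun measurableSet_Ioo key, integral_const_mul] at hv
  constructor
  · simpa [IntegrableOn] using hi.const_mul (1 / 2)
  · linarith

lemma sqrt_sin_integrableOn : IntegrableOn (fun a : ℝ => √(sin a)) (Set.Ioo 0 (π / 2)) := by
  have h := (sin_rpow_integrableOn_and_integral (u := 3 / 4) (by norm_num)).1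
  refine h.congr_fun (fun a _ => ?_) measurableSet_Ioo
  simp only [sqrt_eq_rpow]
  norm_num

lemma inv_sqrt_sin_integrableOn : IntegrableOn (fun a : ℝ => (√(sin a))⁻¹) (Set.Ioo 0 (π / 2)) := by
  have h := (sin_rpow_integrableOn_and_integral (u := 1 / 4) (by norm_num)).1
  refine h.congr_fun (fun a ha => ?_) measurableSet_Ioo
  simp only [sqrt_eq_rpow, ← rpow_neg (sin_pos_and_cos_pos ha).1.le]
  norm_num

lemma integral_sqrt_sin : ∫ a in Set.Ioo (0 : ℝ) (π / 2), √(sin a) =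
    2 * √π * (Gamma (3 / 4) / Gamma (1 / 4)) := by
  have h := (sin_rpow_integrableOn_and_integral (u := 3 / 4) (by norm_num)).2
  have h2 : Gamma (3 / 4 + 1 / 2) = 1 / 4 * Gamma (1 / 4) := by
    rw [← Gamma_add_one (by norm_num)]; norm_num
  rw [ProbabilityTheory.beta, h2, Gamma_one_half_eq] at h
  have e : ∀ a : ℝ, √(sin a) = sin a ^ (2 * (3 / 4 : ℝ) - 1) := fun a => by
    rw [sqrt_eq_rpow]; norm_num
  simp only [e, h]
  have := (Gamma_pos_of_pos (show (0 : ℝ) < 1 / 4 by norm_num)).ne'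
  field_simp
  norm_num

lemma integral_inv_sqrt_sin : ∫ a in Set.Ioo (0 : ℝ) (π / 2), (√(sin a))⁻¹ =
    √π / 2 * (Gamma (1 / 4) / Gamma (3 / 4)) := by
  have h := (sin_rpow_integrableOn_and_integral (u := 1 / 4) (by norm_num)).2
  have h2 : (1 / 4 + 1 / 2 : ℝ) = 3 / 4 := by norm_num
  rw [ProbabilityTheory.beta, h2, Gamma_one_half_eq] at h
  rw [setIntegral_congr_fun (g := fun a => sin a ^ (2 * (1 / 4 : ℝ) - 1)) measurableSet_Ioo
    fun a ha => ?_, h]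
  · ring
  · simp only [sqrt_eq_rpow, ← rpow_neg (sin_pos_and_cos_pos ha).1.le]
    norm_num

/-- The symmetric kernel `2 √(pq) ((p - q) / (p + q))²` with `p = sin a`, `q = sin b`. -/
noncomputable def sinKernel (z : ℝ × ℝ) : ℝ :=
  2 * (√(sin z.1) * √(sin z.2)) * ((sin z.1 - sin z.2) / (sin z.1 + sin z.2)) ^ 2

/-- The `a`-derivative of `cos a * √(pq) (3p + q) / (p + q)²` with `p = sin a`, `q = sin b`. -/
noncomputable def exactKernel (z : ℝ × ℝ) : ℝ :=
  -sin z.1 * (√(sin z.1) * √(sin z.2) * (3 * sin z.1 + sin z.2) / (sin z.1 + sin z.2) ^ 2) +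
    (1 - sin z.1 ^ 2) *
      (√(sin z.2) * (3 * sin z.1 + sin z.2) / (2 * √(sin z.1) * (sin z.1 + sin z.2) ^ 2) +
        3 * (√(sin z.1) * √(sin z.2)) / (sin z.1 + sin z.2) ^ 2 -
        2 * (√(sin z.1) * √(sin z.2)) * (3 * sin z.1 + sin z.2) / (sin z.1 + sin z.2) ^ 3)

lemma sinKernel_eq {a b : ℝ} (ha : 0 < sin a) (hb : 0 < sin b) :
    sinKernel (a, b) = 5 * (√(sin a) * √(sin b)) - (√(sin a))⁻¹ * (√(sin b))⁻¹ +
      2 * (exactKernel (a, b) + exactKernel (b, a)) := by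
  have hr : 0 < √(sin a) := sqrt_pos.2 ha
  have hs : 0 < √(sin b) := sqrt_pos.2 hb
  have hr2 : sin a = √(sin a) ^ 2 := (sq_sqrt ha.le).symm
  have hs2 : sin b = √(sin b) ^ 2 := (sq_sqrt hb.le).symm
  simp only [sinKernel, exactKernel]
  generalize √(sin a) = r at *
  generalize √(sin b) = s at *
  rw [hr2, hs2]
  have h1 : r ^ 2 + s ^ 2 ≠ 0 := by positivity
  rw [add_comm (s ^ 2) (r ^ 2)]
  field_simp
  ring

lemma abs_exactKernel_le {a b : ℝ} (ha : 0 < sin a) (hb : 0 < sin b) :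
    |exactKernel (a, b)| ≤ 15 * ((√(sin a))⁻¹ * (√(sin b))⁻¹) := by
  have hr : 0 < √(sin a) := sqrt_pos.2 ha
  have hs : 0 < √(sin b) := sqrt_pos.2 hb
  have hr2 : sin a = √(sin a) ^ 2 := (sq_sqrt ha.le).symm
  have hs2 : sin b = √(sin b) ^ 2 := (sq_sqrt hb.le).symm
  have ha1 := sin_le_one a
  have hb1 := sin_le_one b
  simp only [exactKernel]
  generalize √(sin a) = r at *
  generalize √(sin b) = s at *
  rw [hr2] at ha1
  rw [hs2] at hb1
  rw [hr2, hs2]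
  set d := r ^ 2 + s ^ 2 with hd
  have hd0 : 0 < d := by positivity
  set t := r⁻¹ * s⁻¹ with ht
  have ht0 : 0 < t := by positivity
  have hrs : 2 * (r * s) ≤ d := by nlinarith [sq_nonneg (r - s)]
  have hw0 : 0 ≤ r * s / d ^ 2 := by positivity
  have hw : r * s / d ^ 2 ≤ t := by
    rw [ht, ← mul_inv, ← one_div, div_le_div_iff₀ (by positivity) (by positivity)]
    nlinarith [mul_pos hr hs]
  have hm : (3 * r ^ 2 + s ^ 2) / d ≤ 3 := by
    rw [div_le_iff₀ hd0]; nlinarith [sq_nonneg s]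
  have hn : s ^ 2 / d ≤ 1 := by
    rw [div_le_one hd0]; nlinarith [sq_nonneg r]
  have e1 : r * s * (3 * r ^ 2 + s ^ 2) / d ^ 2 ≤ 4 * t := by
    rw [mul_div_right_comm]
    calc r * s / d ^ 2 * (3 * r ^ 2 + s ^ 2) ≤ t * 4 := by gcongr; linarith
      _ = 4 * t := mul_comm _ _
  have e2 : s * (3 * r ^ 2 + s ^ 2) / (2 * r * d ^ 2) ≤ 3 / 2 * t := by
    calc s * (3 * r ^ 2 + s ^ 2) / (2 * r * d ^ 2)
        = t / 2 * (s ^ 2 / d * ((3 * r ^ 2 + s ^ 2) / d)) := by rw [ht]; field_simp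
      _ ≤ t / 2 * (1 * 3) := by gcongr
      _ = 3 / 2 * t := by ring
  have e3 : r * s * (3 * r ^ 2 + s ^ 2) / d ^ 3 ≤ 3 * t := by
    calc r * s * (3 * r ^ 2 + s ^ 2) / d ^ 3
        = r * s / d ^ 2 * ((3 * r ^ 2 + s ^ 2) / d) := by field_simp
      _ ≤ t * 3 := by gcongr
      _ = 3 * t := mul_comm _ _
  have hp : |(-r ^ 2 : ℝ)| ≤ 1 := by rw [abs_neg, abs_of_pos (by positivity)]; exact ha1
  have hp' : |1 - (r ^ 2) ^ 2| ≤ 1 := by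
    rw [abs_le]; constructor <;> nlinarith [sq_nonneg r]
  set E₁ := r * s * (3 * r ^ 2 + s ^ 2) / d ^ 2 with hE₁
  set E₂ := s * (3 * r ^ 2 + s ^ 2) / (2 * r * d ^ 2) with hE₂
  have hE₁0 : 0 ≤ E₁ := by positivity
  have hE₂0 : 0 ≤ E₂ := by positivity
  have hE₃0 : 0 ≤ r * s * (3 * r ^ 2 + s ^ 2) / d ^ 3 := by positivity
  calc _ ≤ |(-r ^ 2 : ℝ)| * |E₁| + |1 - (r ^ 2) ^ 2| *
        |E₂ + 3 * (r * s) / d ^ 2 - 2 * (r * s) * (3 * r ^ 2 + s ^ 2) / d ^ 3| := by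
        rw [← abs_mul, ← abs_mul]; exact abs_add_le _ _
    _ ≤ 1 * (4 * t) + 1 * (21 / 2 * t) := by
        gcongr
        · rw [abs_of_nonneg hE₁0]; exact e1
        · rw [mul_div_assoc 3 (r * s), mul_assoc 2 (r * s), mul_div_assoc 2 (r * s * _), abs_le]
          constructor <;> linarith
    _ ≤ 15 * t := by linarith

lemma measurable_exactKernel : Measurable exactKernel := by
  unfold exactKernel
  fun_prop

lemma integral_exactKernel {b : ℝ} (hb : b ∈ Set.Ioo 0 (π / 2)) :
    ∫ a in Set.Ioo (0 : ℝ) (π / 2), exactKernel (a, b) = 0 := by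
  have hb0 := (sin_pos_and_cos_pos hb).1
  have hle : (0 : ℝ) ≤ π / 2 := by positivity
  have hint : IntegrableOn (fun a => exactKernel (a, b)) (Set.Ioo 0 (π / 2)) := by
    refine Integrable.mono' (g := fun a => 15 * ((√(sin a))⁻¹ * (√(sin b))⁻¹))
      ((inv_sqrt_sin_integrableOn.mul_const _).const_mul _)
      (measurable_exactKernel.comp (by fun_prop)).aestronglyMeasurable ?_
    filter_upwards [ae_restrict_mem measurableSet_Ioo] with a ha
    exact abs_exactKernel_le (sin_pos_and_cos_pos ha).1 hb0
  rw [← integral_Ioc_eq_integral_Ioo, ← intervalIntegral.integral_of_le hle]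
  have h := intervalIntegral.integral_eq_sub_of_hasDerivAt_of_le (a := 0) (b := π / 2)
    (f := fun a => cos a * (√(sin a) * √(sin b) * (3 * sin a + sin b) / (sin a + sin b) ^ 2))
    (f' := fun a => exactKernel (a, b)) hle ?_ ?_ ?_
  · rw [h]; simp
  · have : ∀ a ∈ Set.Icc 0 (π / 2), (sin a + sin b) ^ 2 ≠ 0 := fun a ha => by
      have := sin_nonneg_of_nonneg_of_le_pi ha.1 (by linarith [ha.2, pi_pos])
      positivity
    fun_prop (disch := assumption)
  · intro a ha
    have ha0 := (sin_pos_and_cos_pos ha).1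
    have hd := hasDerivAt_sin a
    have h1 := hd.sqrt ha0.ne'
    have h2 := ((hd.const_mul 3).add_const (sin b))
    have h3 := ((hd.add_const (sin b)).pow 2)
    have hne : (sin a + sin b) ^ 2 ≠ 0 := by positivity
    convert! (hasDerivAt_cos a).mul ((((h1.mul_const (√(sin b))).mul h2).div h3 hne)) using 1
    have hr : √(sin a) ≠ 0 := (sqrt_pos.2 ha0).ne'
    have hne' : sin a + sin b ≠ 0 := by positivity
    simp only [exactKernel, ← cos_sq']
    simp only [Pi.pow_apply, Pi.mul_apply, Pi.div_apply]
    field_simp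
    ring
  · rwa [intervalIntegrable_iff_integrableOn_Ioo_of_le hle]

lemma integrableOn_inv_sqrt_sin_mul :
    IntegrableOn (fun z : ℝ × ℝ => (√(sin z.1))⁻¹ * (√(sin z.2))⁻¹)
      (Set.Ioo 0 (π / 2) ×ˢ Set.Ioo 0 (π / 2)) := by
  rw [IntegrableOn, Measure.volume_eq_prod, ← Measure.prod_restrict]
  exact Integrable.mul_prod inv_sqrt_sin_integrableOn inv_sqrt_sin_integrableOn

lemma integrableOn_sqrt_sin_mul :
    IntegrableOn (fun z : ℝ × ℝ => √(sin z.1) * √(sin z.2))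
      (Set.Ioo 0 (π / 2) ×ˢ Set.Ioo 0 (π / 2)) := by
  rw [IntegrableOn, Measure.volume_eq_prod, ← Measure.prod_restrict]
  exact Integrable.mul_prod sqrt_sin_integrableOn sqrt_sin_integrableOn

lemma integrableOn_exactKernel :
    IntegrableOn exactKernel (Set.Ioo 0 (π / 2) ×ˢ Set.Ioo 0 (π / 2)) := by
  refine Integrable.mono' (integrableOn_inv_sqrt_sin_mul.const_mul 15)
    measurable_exactKernel.aestronglyMeasurable ?_
  filter_upwards [ae_restrict_mem (measurableSet_Ioo.prod measurableSet_Ioo)] with z hz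
  exact abs_exactKernel_le (sin_pos_and_cos_pos hz.1).1 (sin_pos_and_cos_pos hz.2).1

lemma integrableOn_exactKernel_swap :
    IntegrableOn (fun z => exactKernel z.swap) (Set.Ioo 0 (π / 2) ×ˢ Set.Ioo 0 (π / 2)) := by
  have h := integrableOn_exactKernel
  rw [IntegrableOn, Measure.volume_eq_prod, ← Measure.prod_restrict] at h ⊢
  exact h.swap

lemma integral_exactKernel_swap :
    ∫ z in Set.Ioo 0 (π / 2) ×ˢ Set.Ioo 0 (π / 2), exactKernel z.swap = 0 := by
  have h := integrableOn_exactKernel_swap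
  rw [IntegrableOn, Measure.volume_eq_prod, ← Measure.prod_restrict] at h
  rw [Measure.volume_eq_prod, ← Measure.prod_restrict, integral_prod _ h]
  exact setIntegral_eq_zero_of_forall_eq_zero fun b hb => integral_exactKernel hb

lemma setIntegral_exactKernel :
    ∫ z in Set.Ioo 0 (π / 2) ×ˢ Set.Ioo 0 (π / 2), exactKernel z = 0 := by
  have h := integral_exactKernel_swap
  rw [Measure.volume_eq_prod, ← Measure.prod_restrict] at h ⊢
  rwa [integral_prod_swap] at h

lemma setIntegral_sinKernel :
    ∫ z in Set.Ioo 0 (π / 2) ×ˢ Set.Ioo 0 (π / 2), sinKernel z =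
      20 * π * (Gamma (3 / 4) ^ 2 / Gamma (1 / 4) ^ 2) -
        π / 4 * (Gamma (1 / 4) ^ 2 / Gamma (3 / 4) ^ 2) := by
  have hcongr : Set.EqOn sinKernel (fun z => 5 * (√(sin z.1) * √(sin z.2)) -
      (√(sin z.1))⁻¹ * (√(sin z.2))⁻¹ + 2 * (exactKernel z + exactKernel z.swap))
      (Set.Ioo 0 (π / 2) ×ˢ Set.Ioo 0 (π / 2)) := fun z hz =>
    sinKernel_eq (sin_pos_and_cos_pos hz.1).1 (sin_pos_and_cos_pos hz.2).1
  have hi₁ : IntegrableOn (fun z : ℝ × ℝ => 5 * (√(sin z.1) * √(sin z.2)) -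
      (√(sin z.1))⁻¹ * (√(sin z.2))⁻¹) (Set.Ioo 0 (π / 2) ×ˢ Set.Ioo 0 (π / 2)) :=
    (integrableOn_sqrt_sin_mul.const_mul 5).sub integrableOn_inv_sqrt_sin_mul
  have hi₂ : IntegrableOn (fun z : ℝ × ℝ => 2 * (exactKernel z + exactKernel z.swap))
      (Set.Ioo 0 (π / 2) ×ˢ Set.Ioo 0 (π / 2)) :=
    (integrableOn_exactKernel.add integrableOn_exactKernel_swap).const_mul 2
  rw [setIntegral_congr_fun (measurableSet_Ioo.prod measurableSet_Ioo) hcongr,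
    integral_add hi₁ hi₂,
    integral_sub (integrableOn_sqrt_sin_mul.const_mul 5) integrableOn_inv_sqrt_sin_mul,
    integral_const_mul, integral_const_mul,
    integral_add integrableOn_exactKernel integrableOn_exactKernel_swap,
    setIntegral_exactKernel, integral_exactKernel_swap, Measure.volume_eq_prod,
    setIntegral_prod_mul (fun a => √(sin a)) (fun a => √(sin a)),
    setIntegral_prod_mul (fun a => (√(sin a))⁻¹) (fun a => (√(sin a))⁻¹),
    integral_sqrt_sin, integral_inv_sqrt_sin]
  have hπ : √π * √π = π := mul_self_sqrt pi_pos.le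
  linear_combination (20 * (Gamma (3 / 4) ^ 2 / Gamma (1 / 4) ^ 2) -
        1 / 4 * (Gamma (1 / 4) ^ 2 / Gamma (3 / 4) ^ 2)) * hπ

/-- The triangle with vertices `(0, 0)`, `(π, 0)`, `(π / 2, π / 2)`. -/
def sinTriangle : Set (ℝ × ℝ) := {z | 0 < z.2 ∧ z.2 < z.1 ∧ z.1 + z.2 < π}

/-- The change of variables sending `sinTriangle` to the unit square. -/
noncomputable def sinChart (z : ℝ × ℝ) : ℝ × ℝ :=
  (sin ((z.1 + z.2) / 2) ^ 2, sin ((z.1 - z.2) / 2) ^ 2 / sin ((z.1 + z.2) / 2) ^ 2)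

/-- The derivative of `sinChart`. -/
noncomputable def fderivSinChart (z : ℝ × ℝ) : ℝ × ℝ →L[ℝ] ℝ × ℝ :=
  (Matrix.toLin (Module.Basis.finTwoProd ℝ) (Module.Basis.finTwoProd ℝ)
    !![sin ((z.1 + z.2) / 2) * cos ((z.1 + z.2) / 2),
        sin ((z.1 + z.2) / 2) * cos ((z.1 + z.2) / 2);
      (sin ((z.1 - z.2) / 2) * cos ((z.1 - z.2) / 2) * sin ((z.1 + z.2) / 2) -
        sin ((z.1 - z.2) / 2) ^ 2 * cos ((z.1 + z.2) / 2)) / sin ((z.1 + z.2) / 2) ^ 3,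
      (-(sin ((z.1 - z.2) / 2) * cos ((z.1 - z.2) / 2) * sin ((z.1 + z.2) / 2)) -
        sin ((z.1 - z.2) / 2) ^ 2 * cos ((z.1 + z.2) / 2)) / sin ((z.1 + z.2) / 2) ^ 3]
    ).toContinuousLinearMap

lemma measurableSet_sinTriangle : MeasurableSet sinTriangle :=
  (measurableSet_lt measurable_const measurable_snd).inter
    ((measurableSet_lt measurable_snd measurable_fst).inter
      (measurableSet_lt (measurable_fst.add measurable_snd) measurable_const))

lemma half_mem_of_mem_sinTriangle {z : ℝ × ℝ} (hz : z ∈ sinTriangle) :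
    (z.1 + z.2) / 2 ∈ Set.Ioo 0 (π / 2) ∧ (z.1 - z.2) / 2 ∈ Set.Ioo 0 (π / 2) := by
  obtain ⟨h1, h2, h3⟩ := hz
  refine ⟨⟨?_, ?_⟩, ⟨?_, ?_⟩⟩ <;> linarith

lemma sin_pos_of_mem_sinTriangle {z : ℝ × ℝ} (hz : z ∈ sinTriangle) :
    0 < sin z.1 ∧ 0 < sin z.2 := by
  obtain ⟨h1, h2, h3⟩ := hz
  constructor <;> apply sin_pos_of_pos_of_lt_pi <;> linarith

lemma injOn_sinChart : Set.InjOn sinChart sinTriangle := by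
  intro z hz w hw h
  obtain ⟨hz1, hz2⟩ := half_mem_of_mem_sinTriangle hz
  obtain ⟨hw1, hw2⟩ := half_mem_of_mem_sinTriangle hw
  simp only [sinChart, Prod.mk.injEq] at h
  obtain ⟨h1, h2⟩ := h
  have hne : sin ((w.1 + w.2) / 2) ^ 2 ≠ 0 := pow_ne_zero 2 (sin_pos_and_cos_pos hw1).1.ne'
  rw [h1, div_left_inj' hne] at h2
  have e1 := injOn_sin_sq hz1 hw1 h1
  have e2 := injOn_sin_sq hz2 hw2 h2
  ext <;> linarith

lemma image_sinChart : sinChart '' sinTriangle = Set.Ioo (0 : ℝ) 1 ×ˢ Set.Ioo (0 : ℝ) 1 := by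
  ext ⟨x, y⟩
  constructor
  · rintro ⟨z, hz, h⟩
    obtain ⟨h1, h2⟩ := half_mem_of_mem_sinTriangle hz
    obtain ⟨hs1, hc1⟩ := sin_pos_and_cos_pos h1
    obtain ⟨hs2, hc2⟩ := sin_pos_and_cos_pos h2
    have hlt : sin ((z.1 - z.2) / 2) < sin ((z.1 + z.2) / 2) :=
      sin_lt_sin_of_lt_of_le_pi_div_two (by linarith [h2.1, pi_pos]) h1.2.le
        (by linarith [hz.1])
    simp only [sinChart, Prod.mk.injEq] at h
    rw [← h.1, ← h.2]
    refine ⟨⟨by positivity, ?_⟩, ⟨by positivity, ?_⟩⟩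
    · show sin ((z.1 + z.2) / 2) ^ 2 < 1
      nlinarith [sin_sq_add_cos_sq ((z.1 + z.2) / 2)]
    · show _ / _ < 1
      rw [div_lt_one (by positivity)]
      exact pow_lt_pow_left₀ hlt hs2.le two_ne_zero
  · rintro ⟨⟨hx0, hx1⟩, ⟨hy0, hy1⟩⟩
    simp only at hx0 hx1 hy0 hy1
    have hxy0 : 0 < x * y := mul_pos hx0 hy0
    have hxy : x * y < x := by nlinarith
    have himg : ∀ t ∈ Set.Ioo (0 : ℝ) 1, ∃ a ∈ Set.Ioo 0 (π / 2), sin a ^ 2 = t := fun t ht => by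
      rwa [← image_sin_sq_Ioo] at ht
    obtain ⟨α, hα, rfl⟩ := himg x ⟨hx0, hx1⟩
    obtain ⟨β, hβ, hβ'⟩ := himg (sin α ^ 2 * y) ⟨hxy0, hxy.trans hx1⟩
    have hlt : β < α := by
      by_contra! hle
      have := sin_le_sin_of_le_of_le_pi_div_two (by linarith [hα.1, pi_pos]) hβ.2.le hle
      have := pow_le_pow_left₀ (sin_pos_and_cos_pos hα).1.le this 2
      linarith
    refine ⟨(α + β, α - β), ⟨?_, ?_, ?_⟩, ?_⟩
    · simpa using hlt
    · show α - β < α + β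
      linarith [hβ.1]
    · show α + β + (α - β) < π
      linarith [hα.2]
    · have e1 : (α + β + (α - β)) / 2 = α := by ring
      have e2 : (α + β - (α - β)) / 2 = β := by ring
      simp only [sinChart, e1, e2, hβ']
      rw [mul_div_cancel_left₀ _ hx0.ne']

lemma hasFDerivAt_sinChart {z : ℝ × ℝ} (hz : sin ((z.1 + z.2) / 2) ≠ 0) :
    HasFDerivAt sinChart (fderivSinChart z) z := by
  have hf := (hasFDerivAt_fst (𝕜 := ℝ) (p := z)).add hasFDerivAt_snd
  have hg := (hasFDerivAt_fst (𝕜 := ℝ) (p := z)).sub hasFDerivAt_snd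
  have hα := ((hf.mul_const (2⁻¹ : ℝ)).sin.pow 2)
  have hβ := ((hg.mul_const (2⁻¹ : ℝ)).sin.pow 2)
  have hne : sin ((z.1 + z.2) * 2⁻¹) ^ 2 ≠ 0 := pow_ne_zero 2 (by rwa [← div_eq_mul_inv])
  have h := hα.prodMk (hβ.mul ((hasDerivAt_inv hne).comp_hasFDerivAt z hα))
  unfold fderivSinChart
  rw [Matrix.toLin_finTwoProd_toContinuousLinearMap]
  convert! h using 1
  simp only [div_eq_mul_inv _ (2 : ℝ)] at hz ⊢
  ext <;> simp <;> field_simp <;> ring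

lemma det_fderivSinChart {z : ℝ × ℝ} (hz : sin ((z.1 + z.2) / 2) ≠ 0) :
    (fderivSinChart z).det = -(2 * cos ((z.1 + z.2) / 2) * sin ((z.1 - z.2) / 2) *
      cos ((z.1 - z.2) / 2) / sin ((z.1 + z.2) / 2)) := by
  unfold fderivSinChart
  simp only [LinearMap.det_toContinuousLinearMap, LinearMap.det_toLin, Matrix.det_fin_two_of]
  field_simp
  ring

lemma abs_det_smul_integrand_eq {z : ℝ × ℝ} (hz : z ∈ sinTriangle) :
    |(fderivSinChart z).det| • ((sinChart z).1 ^ ((1 : ℝ) / 2) *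
      (1 - (sinChart z).1) ^ ((1 : ℝ) / 2) * (sinChart z).2 ^ ((1 : ℝ) / 2) *
      (1 - (sinChart z).2) ^ ((1 : ℝ) / 2) *
      (1 - (sinChart z).1 * (sinChart z).2) ^ (-(3 : ℝ) / 2)) = sinKernel z := by
  obtain ⟨h1, h2⟩ := half_mem_of_mem_sinTriangle hz
  obtain ⟨hs1, hc1⟩ := sin_pos_and_cos_pos h1
  obtain ⟨hs2, hc2⟩ := sin_pos_and_cos_pos h2
  obtain ⟨hsa, hsb⟩ := sin_pos_of_mem_sinTriangle hz
  rw [det_fderivSinChart hs1.ne', abs_neg, abs_of_pos (by positivity)]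
  simp only [sinChart, sinKernel, smul_eq_mul]
  have ea : z.1 = (z.1 + z.2) / 2 + (z.1 - z.2) / 2 := by ring
  have eb : z.2 = (z.1 + z.2) / 2 - (z.1 - z.2) / 2 := by ring
  have hsa' := congrArg sin ea
  have hsb' := congrArg sin eb
  rw [sin_add] at hsa'
  rw [sin_sub] at hsb'
  have q1 := sin_sq_add_cos_sq ((z.1 + z.2) / 2)
  have q2 := sin_sq_add_cos_sq ((z.1 - z.2) / 2)
  generalize sin ((z.1 + z.2) / 2) = sα at *
  generalize cos ((z.1 + z.2) / 2) = cα at *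
  generalize sin ((z.1 - z.2) / 2) = sβ at *
  generalize cos ((z.1 - z.2) / 2) = cβ at *
  have hprod : sin z.1 * sin z.2 = sα ^ 2 - sβ ^ 2 := by
    rw [hsa', hsb']; linear_combination sα ^ 2 * q2 - sβ ^ 2 * q1
  have e1 : 1 - sα ^ 2 = cα ^ 2 := by linarith
  have e2 : 1 - sβ ^ 2 / sα ^ 2 = sin z.1 * sin z.2 / sα ^ 2 := by rw [hprod]; field_simp
  have e3 : sα ^ 2 * (sβ ^ 2 / sα ^ 2) = sβ ^ 2 := by field_simp
  have e4 : 1 - sβ ^ 2 = cβ ^ 2 := by linarith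
  have e5 : (cβ ^ 2) ^ (-(3 : ℝ) / 2) = (cβ ^ 3)⁻¹ := by
    rw [← rpow_natCast, ← rpow_mul hc2.le, ← rpow_natCast cβ 3, ← rpow_neg hc2.le]
    norm_num
  rw [e3, e4, e5, e2, e1, ← sqrt_eq_rpow, ← sqrt_eq_rpow, ← sqrt_eq_rpow, ← sqrt_eq_rpow,
    sqrt_div' _ (by positivity), sqrt_div' _ (by positivity), sqrt_sq hs1.le, sqrt_sq hs2.le,
    sqrt_sq hc1.le, sqrt_mul hsa.le]
  have e6 : sin z.1 - sin z.2 = 2 * (cα * sβ) := by rw [hsa', hsb']; ring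
  have e7 : sin z.1 + sin z.2 = 2 * (sα * cβ) := by rw [hsa', hsb']; ring
  rw [e6, e7]
  field_simp

lemma measurable_sinKernel : Measurable sinKernel := by
  unfold sinKernel
  fun_prop

lemma integrableOn_sinKernel_of_pos {s : Set (ℝ × ℝ)} (hs : MeasurableSet s)
    (hs' : volume s ≠ ⊤) (hpos : ∀ z ∈ s, 0 < sin z.1 ∧ 0 < sin z.2) :
    IntegrableOn sinKernel s := by
  refine Measure.integrableOn_of_bounded (M := 2) hs' measurable_sinKernel.aestronglyMeasurable ?_
  filter_upwards [ae_restrict_mem hs] with z hz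
  obtain ⟨ha, hb⟩ := hpos z hz
  have h1 : √(sin z.1) ≤ 1 := sqrt_le_one.2 (sin_le_one _)
  have h2 : √(sin z.2) ≤ 1 := sqrt_le_one.2 (sin_le_one _)
  have h3 : ((sin z.1 - sin z.2) / (sin z.1 + sin z.2)) ^ 2 ≤ 1 := by
    rw [div_pow, div_le_one (by positivity)]
    nlinarith [mul_pos ha hb]
  have h0 : 0 ≤ sinKernel z := by unfold sinKernel; positivity
  rw [Real.norm_of_nonneg h0]
  calc sinKernel z ≤ 2 * (1 * 1) * 1 := by unfold sinKernel; gcongr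
    _ = 2 := by norm_num

lemma integrableOn_sinKernel_sinTriangle : IntegrableOn sinKernel sinTriangle := by
  refine integrableOn_sinKernel_of_pos measurableSet_sinTriangle ?_
    fun z hz => sin_pos_of_mem_sinTriangle hz
  refine ((measure_mono (t := Set.Icc 0 π ×ˢ Set.Icc 0 π) ?_).trans_lt
    (isCompact_Icc.prod isCompact_Icc).measure_lt_top).ne
  rintro z ⟨h1, h2, h3⟩
  refine ⟨⟨?_, ?_⟩, ⟨?_, ?_⟩⟩ <;> linarith

lemma integrableOn_sinKernel_square :
    IntegrableOn sinKernel (Set.Ioo 0 (π / 2) ×ˢ Set.Ioo 0 (π / 2)) := by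
  refine integrableOn_sinKernel_of_pos (measurableSet_Ioo.prod measurableSet_Ioo) ?_
    fun z hz => ⟨(sin_pos_and_cos_pos hz.1).1, (sin_pos_and_cos_pos hz.2).1⟩
  refine ((measure_mono (t := Set.Icc 0 (π / 2) ×ˢ Set.Icc 0 (π / 2)) ?_).trans_lt
    (isCompact_Icc.prod isCompact_Icc).measure_lt_top).ne
  exact Set.prod_mono Set.Ioo_subset_Icc_self Set.Ioo_subset_Icc_self

/-- The rotation `(a, b) ↦ (b, π - a)` about `(π / 2, π / 2)`. -/
noncomputable def piRotation : ℝ × ℝ ≃ᵐ ℝ × ℝ :=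
  MeasurableEquiv.prodComm.trans
    ((MeasurableEquiv.refl ℝ).prodCongr (MeasurableEquiv.subLeft π))

lemma piRotation_apply (z : ℝ × ℝ) : piRotation z = (z.2, π - z.1) := rfl

lemma measurePreserving_piRotation : MeasurePreserving piRotation := by
  have h1 : MeasurePreserving (Prod.swap : ℝ × ℝ → ℝ × ℝ) := Measure.measurePreserving_swap
  have h2 : MeasurePreserving (Prod.map (id : ℝ → ℝ) (fun x : ℝ => π - x)) :=
    (MeasurePreserving.id (volume : Measure ℝ)).prod (Measure.measurePreserving_sub_left volume π)
  exact h2.comp h1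

lemma sinKernel_piRotation (z : ℝ × ℝ) : sinKernel (piRotation z) = sinKernel z := by
  simp only [piRotation_apply, sinKernel, sin_pi_sub]
  rw [mul_comm (√(sin z.2)), add_comm (sin z.2), ← neg_sub (sin z.1) (sin z.2), neg_div, neg_sq]

lemma volume_fst_eq (c : ℝ) : volume {z : ℝ × ℝ | z.1 = c} = 0 := by
  have : {z : ℝ × ℝ | z.1 = c} = {c} ×ˢ Set.univ := by ext; simp
  rw [this, Measure.volume_eq_prod, Measure.prod_prod]
  simp

lemma setIntegral_sinKernel_sinTriangle :
    ∫ z in sinTriangle, sinKernel z =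
      ∫ z in Set.Ioo 0 (π / 2) ×ˢ Set.Ioo 0 (π / 2), sinKernel z := by
  set Q : Set (ℝ × ℝ) := Set.Ioo 0 (π / 2) ×ˢ Set.Ioo 0 (π / 2) with hQ
  have hQm : MeasurableSet Q := measurableSet_Ioo.prod measurableSet_Ioo
  set L : Set (ℝ × ℝ) := {z | z.2 < z.1} with hL
  have hLm : MeasurableSet L := measurableSet_lt measurable_snd measurable_fst
  have hUm : MeasurableSet {z : ℝ × ℝ | z.1 < z.2} := measurableSet_lt measurable_fst measurable_snd
  set H : Set (ℝ × ℝ) := {z | z.1 < π / 2} with hH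
  have hHm : MeasurableSet H := measurableSet_lt measurable_fst measurable_const
  rw [← integral_inter_add_sdiff hHm integrableOn_sinKernel_sinTriangle,
    ← integral_inter_add_sdiff hLm integrableOn_sinKernel_square]
  congr 1
  · congr 2
    ext ⟨a, b⟩
    simp only [sinTriangle, hH, hL, Set.mem_inter_iff, Set.mem_ofPred_eq, Set.mem_prod,
      Set.mem_Ioo]
    constructor
    · rintro ⟨⟨h1, h2, h3⟩, h4⟩
      refine ⟨⟨⟨?_, ?_⟩, ⟨?_, ?_⟩⟩, ?_⟩ <;> linarith
    · rintro ⟨⟨⟨h1, h2⟩, ⟨h3, h4⟩⟩, h5⟩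
      refine ⟨⟨?_, ?_, ?_⟩, ?_⟩ <;> linarith
  · have hdiag : ∫ z in Q \ L, sinKernel z = ∫ z in Q ∩ {z | z.1 < z.2}, sinKernel z := by
      refine setIntegral_eq_of_subset_of_forall_sdiff_eq_zero (hQm.diff hLm) ?_ ?_
      · exact fun z hz => ⟨hz.1, fun h : z.2 < z.1 => lt_asymm h hz.2⟩
      · intro z hz
        have : z.1 = z.2 := le_antisymm (not_lt.1 hz.1.2)
          (not_lt.1 fun h => hz.2 ⟨hz.1.1, h⟩)
        simp [sinKernel, this]
    rw [hdiag, ← measurePreserving_piRotation.setIntegral_preimage_emb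
      piRotation.measurableEmbedding sinKernel (Q ∩ {z | z.1 < z.2})]
    simp only [sinKernel_piRotation]
    refine setIntegral_congr_set ?_
    have hnull : ∀ᵐ z : ℝ × ℝ, z.1 ≠ π / 2 := by
      rw [ae_iff]; simpa using volume_fst_eq (π / 2)
    filter_upwards [hnull] with z hz
    apply propext
    show z ∈ sinTriangle \ H ↔ z ∈ piRotation ⁻¹' (Q ∩ {z | z.1 < z.2})
    simp only [sinTriangle, hH, hQ, Set.mem_sdiff, Set.mem_inter_iff, Set.mem_ofPred_eq,
      Set.mem_prod, Set.mem_Ioo, Set.mem_preimage, piRotation_apply, not_lt]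
    constructor
    · rintro ⟨⟨h1, h2, h3⟩, h4⟩
      have h4 := lt_of_le_of_ne h4 hz.symm
      refine ⟨⟨⟨?_, ?_⟩, ⟨?_, ?_⟩⟩, ?_⟩ <;> linarith
    · rintro ⟨⟨⟨h1, h2⟩, ⟨h3, h4⟩⟩, h5⟩
      refine ⟨⟨?_, ?_, ?_⟩, ?_⟩ <;> linarith

/-- `∬_{[0,1]²} √(x(1-x)y(1-y))/(1-xy)^{3/2} dx dy` converges and its negative equals
`(π/4)Γ(1/4)²/Γ(3/4)² - 20π Γ(3/4)²/Γ(1/4)²`. -/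
theorem I₂_one_eval :
    IntegrableOn
      (fun p : ℝ × ℝ =>
        p.1 ^ ((1 : ℝ) / 2) * (1 - p.1) ^ ((1 : ℝ) / 2) *
          p.2 ^ ((1 : ℝ) / 2) * (1 - p.2) ^ ((1 : ℝ) / 2) *
          (1 - p.1 * p.2) ^ (-(3 : ℝ) / 2))
      (Set.Ioo (0 : ℝ) 1 ×ˢ Set.Ioo (0 : ℝ) 1) ∧
    -(∫ p in Set.Ioo (0 : ℝ) 1 ×ˢ Set.Ioo (0 : ℝ) 1,
        p.1 ^ ((1 : ℝ) / 2) * (1 - p.1) ^ ((1 : ℝ) / 2) *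
          p.2 ^ ((1 : ℝ) / 2) * (1 - p.2) ^ ((1 : ℝ) / 2) *
          (1 - p.1 * p.2) ^ (-(3 : ℝ) / 2))
      = π / 4 * (Real.Gamma (1 / 4) ^ 2 / Real.Gamma (3 / 4) ^ 2)
          - 20 * π * (Real.Gamma (3 / 4) ^ 2 / Real.Gamma (1 / 4) ^ 2) := by
  have hd : ∀ z ∈ sinTriangle,
      HasFDerivWithinAt sinChart (fderivSinChart z) sinTriangle z := fun z hz =>
    (hasFDerivAt_sinChart
      (sin_pos_and_cos_pos (half_mem_of_mem_sinTriangle hz).1).1.ne').hasFDerivWithinAt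
  rw [← image_sinChart,
    integrableOn_image_iff_integrableOn_abs_det_fderiv_smul volume measurableSet_sinTriangle hd
      injOn_sinChart,
    integral_image_eq_integral_abs_det_fderiv_smul volume measurableSet_sinTriangle hd
      injOn_sinChart,
    integrableOn_congr_fun (fun z hz => abs_det_smul_integrand_eq hz) measurableSet_sinTriangle,
    setIntegral_congr_fun measurableSet_sinTriangle fun z hz => abs_det_smul_integrand_eq hz,
    setIntegral_sinKernel_sinTriangle, setIntegral_sinKernel]
  exact ⟨integrableOn_sinKernel_sinTriangle, by ring⟩
end
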